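/- Let M be locally compact and μ doubling with μ(M) = ∞. Then there exists a constant C such that ‖f‖_{H¹} ≤ ‖f‖_{F^C} ≤ C·‖f‖_{H¹} for every f that is a finite linear combination of continuous (1,∞)-atoms (not necessarily compactly supported), where ‖f‖_{F^C} = inf{Σ_{j=1}^N |c_j| : f = Σ_{j=1}^N c_j b_j, each b_j a continuous (1,∞)-atom, N ∈ ℕ}. -/

import Mathlib

open MeasureTheory Metric Filter

/-- A `(1,∞)`-atom: a bounded measurable function supported in some open ball `B` with
`‖a‖_∞ ≤ μ(B)⁻¹` and mean zero. -/
def IsOneInfAtom {M : Type*} [MetricSpace M] [MeasurableSpace M]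
    (μ : MeasureTheory.Measure M) (a : M → ℝ) : Prop :=
  Measurable a ∧ ∃ (x : M) (r : ℝ), 0 < r ∧ (∀ y, y ∉ ball x r → a y = 0) ∧
    (∀ᵐ y ∂μ, |a y| ≤ ((μ (ball x r)).toReal)⁻¹) ∧ (∫ y, a y ∂μ) = 0

/-- A continuous `(1,∞)`-atom (not necessarily compactly supported). -/
def IsContAtom {M : Type*} [MetricSpace M] [MeasurableSpace M]
    (μ : MeasureTheory.Measure M) (a : M → ℝ) : Prop :=
  IsOneInfAtom μ a ∧ Continuous a

namespace FiniteAtomic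

open Set

variable {M : Type*} [MetricSpace M]

/-- The tent function of the ball `ball x r`. -/
noncomputable def tent (x : M) (r : ℝ) (y : M) : ℝ := max 0 (1 - dist y x / r)

lemma tent_nonneg (x : M) (r : ℝ) (y : M) : 0 ≤ tent x r y := le_max_left _ _

lemma tent_le_one (x : M) {r : ℝ} (hr : 0 < r) (y : M) : tent x r y ≤ 1 :=
  max_le zero_le_one (by have : 0 ≤ dist y x / r := by positivity
                         linarith)

lemma tent_eq_zero {x : M} {r : ℝ} (hr : 0 < r) {y : M} (hy : y ∉ ball x r) : tent x r y = 0 := by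
  rw [mem_ball, not_lt] at hy
  refine max_eq_left ?_
  have := (one_le_div hr).2 hy
  linarith

lemma uniformContinuous_tent (x : M) (r : ℝ) : UniformContinuous (tent x r) := by
  have : UniformContinuous fun t : ℝ => max 0 (1 - t / r) := by
    refine LipschitzWith.uniformContinuous (K := ⟨|r⁻¹|, abs_nonneg _⟩)
      (LipschitzWith.of_dist_le_mul fun s t => ?_)
    rw [Real.dist_eq, Real.dist_eq]
    refine (abs_max_sub_max_le_max _ _ _ _).trans (max_le ?_ ?_)
    · rw [sub_self, abs_zero]; exact mul_nonneg (NNReal.coe_nonneg _) (abs_nonneg _)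
    · rw [show (1 - s / r - (1 - t / r)) = r⁻¹ * (t - s) by ring, abs_mul, abs_sub_comm]; rfl
  exact this.comp (uniformContinuous_id.dist uniformContinuous_const)

lemma continuous_tent (x : M) (r : ℝ) : Continuous (tent x r) :=
  (uniformContinuous_tent x r).continuous

variable [MeasurableSpace M]

/-- Balls have positive finite measure, and `μ` is doubling with constant `D`. -/
structure BallDoubling (μ : Measure M) (D : ℝ) : Prop where
  one_le : 1 ≤ D
  pos : ∀ (x : M) (r : ℝ), 0 < r → 0 < μ (ball x r)
  lt_top : ∀ (x : M) (r : ℝ), 0 < r → μ (ball x r) < ⊤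
  doubling : ∀ (x : M) (r : ℝ), 0 < r → μ (ball x (2 * r)) ≤ ENNReal.ofReal D * μ (ball x r)

/-- `f` is a finite combination of continuous atoms vanishing off `S`, with coefficients of total
size at most `T`. -/
def FinAtomic (μ : Measure M) (S : Set M) (T : ℝ) (f : M → ℝ) : Prop :=
  ∃ (N : ℕ) (c : ℕ → ℝ) (b : ℕ → M → ℝ),
    (∀ j, j < N → IsContAtom μ (b j) ∧ ∀ y ∉ S, b j y = 0) ∧
    (∀ x, f x = ∑ j ∈ Finset.range N, c j * b j x) ∧ ∑ j ∈ Finset.range N, |c j| ≤ T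

section Real

/-- Truncation of a real number to `[-a, a]`. -/
def clamp (a t : ℝ) : ℝ := max (-a) (min t a)

lemma continuous_clamp (a : ℝ) : Continuous (clamp a) := by
  unfold clamp; fun_prop

lemma abs_clamp_le {a : ℝ} (ha : 0 ≤ a) (t : ℝ) : |clamp a t| ≤ a := by
  unfold clamp
  rw [abs_le]
  exact ⟨le_max_left _ _, max_le (by linarith) (min_le_right _ _)⟩

lemma clamp_zero {a : ℝ} (ha : 0 ≤ a) : clamp a 0 = 0 := by
  unfold clamp; rw [min_eq_left ha, max_eq_right (by linarith)]

lemma clamp_eq_self {a t : ℝ} (h : |t| ≤ a) : clamp a t = t := by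
  rw [abs_le] at h
  unfold clamp; rw [min_eq_left h.2, max_eq_right h.1]

lemma abs_clamp_sub_clamp_le (a s t : ℝ) : |clamp a s - clamp a t| ≤ |s - t| := by
  unfold clamp
  refine (abs_max_sub_max_le_max _ _ _ _).trans ?_
  refine max_le (by simp) ?_
  refine (abs_min_sub_min_le_max _ _ _ _).trans ?_
  simp

lemma abs_clamp_add_abs_sub_clamp {a : ℝ} (ha : 0 ≤ a) (t : ℝ) :
    |clamp a t| + |t - clamp a t| = |t| := by
  unfold clamp
  rcases le_total t a with h | h
  · rw [min_eq_left h]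
    rcases le_total (-a) t with h' | h'
    · rw [max_eq_right h']; simp
    · rw [max_eq_left h', abs_neg, abs_of_nonneg ha, abs_of_nonpos (by linarith),
        abs_of_nonpos (by linarith)]
      ring
  · rw [min_eq_right h, max_eq_right (by linarith), abs_of_nonneg ha, abs_of_nonneg (by linarith),
        abs_of_nonneg (by linarith)]
    ring

lemma uniformContinuous_clamp (a : ℝ) : UniformContinuous (clamp a) := by
  refine LipschitzWith.uniformContinuous (K := 1) (LipschitzWith.of_dist_le_mul fun s t => ?_)
  simpa [Real.dist_eq] using abs_clamp_sub_clamp_le a s t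

lemma abs_clamp_le_abs {a : ℝ} (ha : 0 ≤ a) (t : ℝ) : |clamp a t| ≤ |t| := by
  have := abs_clamp_add_abs_sub_clamp ha t
  have := abs_nonneg (t - clamp a t)
  linarith

end Real

namespace FinAtomic

variable {μ : Measure M} {S S' : Set M} {T T' : ℝ} {f g : M → ℝ}

lemma mono (h : FinAtomic μ S T f) (hS : S ⊆ S') (hT : T ≤ T') : FinAtomic μ S' T' f := by
  obtain ⟨N, c, b, hb, hf, hc⟩ := h
  exact ⟨N, c, b, fun j hj => ⟨(hb j hj).1, fun y hy => (hb j hj).2 y fun h => hy (hS h)⟩,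
    hf, hc.trans hT⟩

lemma congr (h : FinAtomic μ S T f) (hfg : ∀ x, g x = f x) : FinAtomic μ S T g := by
  rwa [show g = f from funext hfg]

lemma zero (hT : 0 ≤ T) : FinAtomic μ S T (fun _ => 0) :=
  ⟨0, fun _ => 0, fun _ _ => 0, by simp, by simp, by simpa using hT⟩

lemma nonneg (h : FinAtomic μ S T f) : 0 ≤ T := by
  obtain ⟨N, c, b, hb, hf, hc⟩ := h
  exact (Finset.sum_nonneg fun _ _ => abs_nonneg _).trans hc

lemma add (hf : FinAtomic μ S T f) (hg : FinAtomic μ S T' g) :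
    FinAtomic μ S (T + T') (fun x => f x + g x) := by
  obtain ⟨N, c, b, hb, hf, hc⟩ := hf
  obtain ⟨N', c', b', hb', hg, hc'⟩ := hg
  refine ⟨N + N', fun j => if j < N then c j else c' (j - N),
    fun j => if j < N then b j else b' (j - N), fun j hj => ?_, fun x => ?_, ?_⟩
  · by_cases h : j < N
    · simpa [h] using hb j h
    · simpa [h] using hb' (j - N) (by omega)
  · rw [Finset.sum_range_add]
    refine congrArg₂ _ ((hf x).trans ?_) ((hg x).trans ?_)
    · refine Finset.sum_congr rfl fun j hj => ?_
      simp [Finset.mem_range.1 hj]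
    · refine Finset.sum_congr rfl fun j hj => ?_
      simp
  · rw [Finset.sum_range_add]
    refine add_le_add (le_trans (le_of_eq ?_) hc) (le_trans (le_of_eq ?_) hc')
    · refine Finset.sum_congr rfl fun j hj => ?_
      simp [Finset.mem_range.1 hj]
    · refine Finset.sum_congr rfl fun j hj => ?_
      simp

lemma smul (hf : FinAtomic μ S T f) (a : ℝ) : FinAtomic μ S (|a| * T) (fun x => a * f x) := by
  obtain ⟨N, c, b, hb, hf, hc⟩ := hf
  refine ⟨N, fun j => a * c j, b, hb, fun x => ?_, ?_⟩
  · simp only [hf x, Finset.mul_sum]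
    exact Finset.sum_congr rfl fun j _ => by ring
  · simp only [abs_mul, ← Finset.mul_sum]
    gcongr

lemma sum {ι : Type*} (s : Finset ι) {t : ι → ℝ} {u : ι → M → ℝ}
    (h : ∀ i ∈ s, FinAtomic μ S (t i) (u i)) :
    FinAtomic μ S (∑ i ∈ s, t i) (fun x => ∑ i ∈ s, u i x) := by
  classical
  induction s using Finset.induction_on with
  | empty => simpa using zero le_rfl
  | insert i s hi ih =>
    simp only [Finset.sum_insert hi]
    exact (h i (by simp)).add (ih fun j hj => h j (by simp [hj]))

end FinAtomic

namespace BallDoubling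

variable {μ : Measure M} {D : ℝ} (h : BallDoubling μ D)
include h

lemma D_pos : 0 < D := zero_lt_one.trans_le h.one_le

lemma real_pos (x : M) {r : ℝ} (hr : 0 < r) : 0 < μ.real (ball x r) :=
  ENNReal.toReal_pos (h.pos x r hr).ne' (h.lt_top x r hr).ne

lemma real_mono {x y : M} {r s : ℝ} (hs : 0 < s) (hsub : ball x r ⊆ ball y s) :
    μ.real (ball x r) ≤ μ.real (ball y s) :=
  measureReal_mono hsub (h.lt_top y s hs).ne

lemma real_two (x : M) {r : ℝ} (hr : 0 < r) :
    μ.real (ball x (2 * r)) ≤ D * μ.real (ball x r) := by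
  have := ENNReal.toReal_mono (ENNReal.mul_ne_top ENNReal.ofReal_ne_top (h.lt_top x r hr).ne)
    (h.doubling x r hr)
  rwa [ENNReal.toReal_mul, ENNReal.toReal_ofReal h.D_pos.le] at this

lemma real_two_pow (x : M) {r : ℝ} (hr : 0 < r) (k : ℕ) :
    μ.real (ball x (2 ^ k * r)) ≤ D ^ k * μ.real (ball x r) := by
  induction k with
  | zero => simp
  | succ k ih =>
    rw [pow_succ', pow_succ', mul_assoc, mul_assoc]
    refine (h.real_two x (by positivity)).trans ?_
    have := h.D_pos
    gcongr

lemma real_four (x : M) {r : ℝ} (hr : 0 < r) :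
    μ.real (ball x (4 * r)) ≤ D ^ 2 * μ.real (ball x r) := by
  have := h.real_two_pow x hr 2
  norm_num at this; exact this

lemma real_eight (x : M) {r : ℝ} (hr : 0 < r) :
    μ.real (ball x (8 * r)) ≤ D ^ 3 * μ.real (ball x r) := by
  have := h.real_two_pow x hr 3
  norm_num at this; exact this

lemma integrable_of_bdd {g : M → ℝ} (hg : Measurable g) {x : M} {r K : ℝ} (hr : 0 < r)
    (hs : ∀ y ∉ ball x r, g y = 0) (hK : ∀ᵐ y ∂μ, |g y| ≤ K) : Integrable g μ := by
  have : IntegrableOn g (ball x r) μ :=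
    Measure.integrableOn_of_bounded (h.lt_top x r hr).ne hg.aestronglyMeasurable
      (ae_restrict_of_ae hK)
  exact this.integrable_of_forall_notMem_eq_zero hs

lemma integral_abs_le [OpensMeasurableSpace M] {g : M → ℝ} (hg : Measurable g) {x : M} {r K : ℝ}
    (hr : 0 < r)
    (hs : ∀ y ∉ ball x r, g y = 0) (hK : ∀ᵐ y ∂μ, |g y| ≤ K) :
    ∫ y, |g y| ∂μ ≤ K * μ.real (ball x r) := by
  have hi := h.integrable_of_bdd hg hr hs hK
  rw [← setIntegral_eq_integral_of_forall_compl_eq_zero (s := ball x r)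
    (fun y hy => by simp [hs y hy])]
  calc ∫ y in ball x r, |g y| ∂μ ≤ ∫ y in ball x r, K ∂μ := by
        refine setIntegral_mono_ae hi.abs.integrableOn ?_ hK
        exact integrableOn_const (h.lt_top x r hr).ne
    _ = K * μ.real (ball x r) := by simp [mul_comm]

end BallDoubling

section Bump

/-- The tent function of a ball, normalized to have integral one. -/
noncomputable def bump (μ : Measure M) (x : M) (r : ℝ) (y : M) : ℝ :=
  (∫ z, tent x r z ∂μ)⁻¹ * tent x r y

variable {μ : Measure M} {D : ℝ}

lemma uniformContinuous_bump (x : M) (r : ℝ) : UniformContinuous (bump μ x r) := by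
  unfold bump
  exact (uniformContinuous_tent x r).const_mul' _

lemma continuous_bump (x : M) (r : ℝ) : Continuous (bump μ x r) :=
  (uniformContinuous_bump x r).continuous

lemma bump_nonneg (x : M) (r : ℝ) (y : M) : 0 ≤ bump μ x r y :=
  mul_nonneg (inv_nonneg.2 (integral_nonneg (tent_nonneg x r))) (tent_nonneg x r y)

lemma bump_eq_zero {x : M} {r : ℝ} (hr : 0 < r) {y : M} (hy : y ∉ ball x r) :
    bump μ x r y = 0 := by
  rw [bump, tent_eq_zero hr hy, mul_zero]

variable [BorelSpace M] (h : BallDoubling μ D)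
include h

lemma integrable_tent (x : M) {r : ℝ} (hr : 0 < r) : Integrable (tent x r) μ :=
  h.integrable_of_bdd (continuous_tent x r).measurable hr (fun _ => tent_eq_zero hr)
    (K := 1) (ae_of_all _ fun y => by
      rw [abs_of_nonneg (tent_nonneg x r y)]; exact tent_le_one x hr y)

lemma le_integral_tent (x : M) {r : ℝ} (hr : 0 < r) :
    (2 * D)⁻¹ * μ.real (ball x r) ≤ ∫ y, tent x r y ∂μ := by
  have hD := h.D_pos
  have h1 : μ.real (ball x r) ≤ D * μ.real (ball x (r / 2)) := by
    have := h.real_two x (half_pos hr)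
    rwa [mul_div_cancel₀ _ two_ne_zero] at this
  calc (2 * D)⁻¹ * μ.real (ball x r) ≤ (2 * D)⁻¹ * (D * μ.real (ball x (r / 2))) := by gcongr
    _ = ∫ y in ball x (r / 2), (1 / 2 : ℝ) ∂μ := by
        simp only [setIntegral_const, smul_eq_mul]; field_simp
    _ ≤ ∫ y in ball x (r / 2), tent x r y ∂μ := by
        refine setIntegral_mono_on (integrableOn_const (h.lt_top x _ (half_pos hr)).ne)
          (integrable_tent h x hr).integrableOn measurableSet_ball fun y hy => ?_
        refine le_trans ?_ (le_max_right _ _)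
        have : dist y x / r ≤ 1 / 2 := by
          rw [div_le_iff₀ hr]; have := mem_ball.1 hy; linarith
        linarith
    _ ≤ ∫ y, tent x r y ∂μ :=
        setIntegral_le_integral (integrable_tent h x hr) (ae_of_all _ (tent_nonneg x r))

lemma integral_bump (x : M) {r : ℝ} (hr : 0 < r) : ∫ y, bump μ x r y ∂μ = 1 := by
  unfold bump
  rw [integral_const_mul, inv_mul_cancel₀]
  have := le_integral_tent h x hr
  have hD := h.D_pos
  have := h.real_pos x hr
  have : 0 < (2 * D)⁻¹ * μ.real (ball x r) := by positivity
  linarith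

lemma bump_le (x : M) {r : ℝ} (hr : 0 < r) (y : M) :
    bump μ x r y ≤ 2 * D / μ.real (ball x r) := by
  have h1 := le_integral_tent h x hr
  have hD := h.D_pos
  have hV := h.real_pos x hr
  have : 0 < (2 * D)⁻¹ * μ.real (ball x r) := by positivity
  calc bump μ x r y ≤ ((2 * D)⁻¹ * μ.real (ball x r))⁻¹ * 1 := by
        unfold bump
        gcongr
        · exact tent_nonneg x r y
        · exact tent_le_one x hr y
    _ = _ := by field_simp

lemma abs_bump_le (x : M) {r : ℝ} (hr : 0 < r) (y : M) :
    |bump μ x r y| ≤ 2 * D / μ.real (ball x r) := by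
  rw [abs_of_nonneg (bump_nonneg x r y)]; exact bump_le h x hr y

lemma integrable_bump (x : M) {r : ℝ} (hr : 0 < r) : Integrable (bump μ x r) μ :=
  (integrable_tent h x hr).const_mul _

end Bump

section Atoms

variable [BorelSpace M] {μ : Measure M} {D : ℝ} (h : BallDoubling μ D)
include h

lemma finAtomic_single {g : M → ℝ} (hg : Continuous g) {x : M} {r L : ℝ} (hr : 0 < r)
    (hL : 0 ≤ L) (hs : ∀ y ∉ ball x r, g y = 0) (hb : ∀ y, |g y| ≤ L) (h0 : ∫ y, g y ∂μ = 0) :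
    FinAtomic μ (ball x r) (L * μ.real (ball x r)) g := by
  have hV := h.real_pos x hr
  rcases hL.eq_or_lt with rfl | hL
  · refine (FinAtomic.zero (by simp)).congr fun y => ?_
    exact abs_nonpos_iff.1 (hb y)
  · refine ⟨1, fun _ => L * μ.real (ball x r), fun _ y => (L * μ.real (ball x r))⁻¹ * g y,
      fun j _ => ⟨⟨⟨(hg.measurable.const_mul _), x, r, hr, fun y hy => by simp [hs y hy],
        ae_of_all _ fun y => ?_, ?_⟩, hg.const_smul (L * μ.real (ball x r))⁻¹⟩,
        fun y hy => by simp [hs y hy]⟩, fun y => ?_, ?_⟩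
    · rw [abs_mul, abs_of_pos (by positivity : 0 < (L * μ.real (ball x r))⁻¹)]
      change _ ≤ (μ.real (ball x r))⁻¹
      calc (L * μ.real (ball x r))⁻¹ * |g y| ≤ (L * μ.real (ball x r))⁻¹ * L := by
            gcongr; exact hb y
        _ = _ := by field_simp
    · rw [integral_const_mul, h0, mul_zero]
    · simp; field_simp
    · simp [abs_of_pos hL, abs_of_pos hV]

/-- Moving the mass of `g` to a bump on a ball inside the supporting ball. -/
lemma finAtomic_sub_bump {g : M → ℝ} (hg : Continuous g) {x z : M} {r r' K m : ℝ} (hr : 0 < r)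
    (hr' : 0 < r') (hsub : ball z r' ⊆ ball x r) (hK : 0 ≤ K)
    (hs : ∀ y ∉ ball x r, g y = 0) (hb : ∀ y, |g y| ≤ K) (hm : |∫ y, g y ∂μ| ≤ m) :
    FinAtomic μ (ball x r) ((K + m * (2 * D / μ.real (ball z r'))) * μ.real (ball x r))
      (fun y => g y - (∫ w, g w ∂μ) * bump μ z r' y) := by
  have hV := h.real_pos z hr'
  have hD := h.D_pos
  have hm0 : 0 ≤ m := (abs_nonneg _).trans hm
  have hcont : Continuous fun y => g y - (∫ w, g w ∂μ) * bump μ z r' y :=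
    hg.sub (continuous_const.mul (continuous_bump z r'))
  refine finAtomic_single h hcont hr (by positivity) (fun y hy => ?_) (fun y => ?_) ?_
  · rw [hs y hy, bump_eq_zero hr' fun hy' => hy (hsub hy')]; simp
  · refine (abs_sub _ _).trans ?_
    rw [abs_mul]
    gcongr
    · exact hb y
    · exact abs_bump_le h z hr' y
  · rw [integral_sub, integral_const_mul, integral_bump h z hr']
    · simp
    · exact h.integrable_of_bdd hg.measurable hr hs (ae_of_all _ hb)
    · exact (integrable_bump h z hr').const_mul _

end Atoms

section Spread

variable [BorelSpace M] {μ : Measure M} {D : ℝ}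

lemma sum_real_ball_le {ι : Type*} (s : Finset ι) {x : ι → M} {r : ι → ℝ} {A : Set M}
    (hd : (s : Set ι).PairwiseDisjoint fun i => ball (x i) (r i)) (hA : μ A ≠ ⊤)
    (hsub : ∀ i ∈ s, ball (x i) (r i) ⊆ A) : ∑ i ∈ s, μ.real (ball (x i) (r i)) ≤ μ.real A := by
  have hfin : ∀ i ∈ s, μ (ball (x i) (r i)) ≠ ⊤ := fun i hi =>
    ((measure_mono (hsub i hi)).trans_lt hA.lt_top).ne
  rw [← measureReal_biUnion_finset hd (fun i _ => measurableSet_ball) hfin]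
  exact measureReal_mono (iUnion₂_subset hsub) hA

lemma sum_setIntegral_ball_le {ι : Type*} (s : Finset ι) {x : ι → M} {r : ι → ℝ}
    (hd : (s : Set ι).PairwiseDisjoint fun i => ball (x i) (r i)) {u : M → ℝ}
    (hu : Integrable u μ) :
    ∑ i ∈ s, ∫ y in ball (x i) (r i), |u y| ∂μ ≤ ∫ y, |u y| ∂μ := by
  rw [← integral_biUnion_finset s (fun i _ => measurableSet_ball) hd
    fun i _ => hu.abs.integrableOn]
  exact setIntegral_le_integral hu.abs (ae_of_all _ fun y => abs_nonneg _)

lemma BallDoubling.exists_finset_cover (h : BallDoubling μ D) {E : Set M} {x₀ : M} {ρ t R : ℝ}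
    (hρ : 0 < ρ) (hE : E ⊆ ball x₀ ρ) (ht : 0 < t) {r : M → ℝ} (htr : ∀ x ∈ E, t ≤ r x)
    (hrR : ∀ x ∈ E, r x ≤ R) :
    ∃ s : Finset M, ↑s ⊆ E ∧ (s : Set M).PairwiseDisjoint (fun x => ball x (r x)) ∧
      ∀ y ∈ E, ∃ x ∈ s, y ∈ ball x (4 * r x) := by
  obtain ⟨u, huE, hud, hu⟩ := Vitali.exists_disjoint_subfamily_covering_enlargement_ball E
    (fun x => x) r R hrR 4 (by norm_num)
  obtain ⟨k, hk⟩ := pow_unbounded_of_one_lt (2 * ρ / t) one_lt_two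
  have hk' : 2 * ρ ≤ 2 ^ k * t := by rw [div_lt_iff₀ ht] at hk; exact hk.le
  have hD := h.D_pos
  have hlow : ∀ x ∈ E, μ.real (ball x₀ ρ) / D ^ k ≤ μ.real (ball x (r x)) := fun x hx => by
    rw [div_le_iff₀' (by positivity)]
    refine le_trans (h.real_mono (by positivity) ?_)
      ((h.real_two_pow x ht k).trans ?_)
    · refine ball_subset_ball' ?_
      have := mem_ball'.1 (hE hx)
      linarith
    · gcongr
      exacts [(h.lt_top _ _ (ht.trans_le (htr x hx))).ne, htr x hx]
  have hV := h.real_pos x₀ hρ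
  have hfin : u.Finite := by
    by_contra hinf
    obtain ⟨n, hn⟩ := exists_nat_gt (μ.real (ball x₀ (ρ + R)) / (μ.real (ball x₀ ρ) / D ^ k))
    obtain ⟨w, hwu, hwn⟩ := Set.Infinite.exists_subset_card_eq hinf n
    have hne : u.Nonempty := Set.Infinite.nonempty hinf
    obtain ⟨x, hx⟩ := hne
    have hR : 0 < R := ht.trans_le ((htr x (huE hx)).trans (hrR x (huE hx)))
    have h1 : ∑ x ∈ w, μ.real (ball x (r x)) ≤ μ.real (ball x₀ (ρ + R)) := by
      refine sum_real_ball_le w (hud.subset hwu) (h.lt_top _ _ (by positivity)).ne fun x hx => ?_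
      refine ball_subset_ball' ?_
      have := mem_ball.1 (hE (huE (hwu hx)))
      have := hrR x (huE (hwu hx))
      linarith
    have h2 : n * (μ.real (ball x₀ ρ) / D ^ k) ≤ ∑ x ∈ w, μ.real (ball x (r x)) := by
      rw [← hwn, ← nsmul_eq_mul]
      exact Finset.card_nsmul_le_sum _ _ _ fun x hx => hlow x (huE (hwu hx))
    rw [div_lt_iff₀ (by positivity)] at hn
    linarith
  refine ⟨hfin.toFinset, by simpa using huE, by simpa using hud, fun y hy => ?_⟩
  obtain ⟨b, hb, hyb⟩ := hu y hy
  exact ⟨b, by simpa using hb, hyb (mem_ball_self (ht.trans_le (htr y hy)))⟩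

lemma abs_sum_bump_le (h : BallDoubling μ D) {ι : Type*} (s : Finset ι) {x : ι → M} {r : ι → ℝ}
    (hr : ∀ i ∈ s, 0 < r i) (hd : (s : Set ι).PairwiseDisjoint fun i => ball (x i) (r i))
    {c : ι → ℝ} {L : ℝ} (hL : 0 ≤ L) (hc : ∀ i ∈ s, |c i| ≤ L * μ.real (ball (x i) (r i))) (y : M) :
    |∑ i ∈ s, c i * bump μ (x i) (r i) y| ≤ 2 * D * L := by
  have hD := h.D_pos
  by_cases hy : ∃ i ∈ s, y ∈ ball (x i) (r i)
  · obtain ⟨i, hi, hyi⟩ := hy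
    rw [Finset.sum_eq_single_of_mem i hi]
    · have hV := h.real_pos (x i) (hr i hi)
      rw [abs_mul]
      calc |c i| * |bump μ (x i) (r i) y|
          ≤ (L * μ.real (ball (x i) (r i))) * (2 * D / μ.real (ball (x i) (r i))) := by
            gcongr
            · exact hc i hi
            · exact abs_bump_le h _ (hr i hi) y
        _ = 2 * D * L := by field_simp
    · intro j hj hji
      rw [bump_eq_zero (hr j hj), mul_zero]
      exact fun hyj => (Set.disjoint_left.1 (hd hj hi hji)) hyj hyi
  · push Not at hy
    rw [Finset.sum_eq_zero, abs_zero]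
    · positivity
    · intro i hi
      rw [bump_eq_zero (hr i hi) (hy i hi), mul_zero]

/-- A function carried by finitely many balls is, up to a finite combination of atoms, a
combination of bumps. -/
lemma exists_spread (h : BallDoubling μ D) {ι : Type*} (s : Finset ι) {x : ι → M} {r : ι → ℝ}
    (hr : ∀ i ∈ s, 0 < r i) {S : Set M} (hS : ∀ i ∈ s, ball (x i) (8 * r i) ⊆ S) {v : M → ℝ}
    (hv : Continuous v) (hvi : Integrable v μ) {K : ℝ} (hK : 0 ≤ K) (hvK : ∀ y, |v y| ≤ K)
    (hvs : ∀ y, v y ≠ 0 → ∃ i ∈ s, y ∈ ball (x i) (4 * r i)) :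
    ∃ c : ι → ℝ,
      FinAtomic μ S (K * (D ^ 3 * (1 + 2 * D * D ^ 3)) * ∑ i ∈ s, μ.real (ball (x i) (r i)))
        (fun y => v y - ∑ i ∈ s, c i * bump μ (x i) (r i) y) ∧
      (∀ i ∈ s, |c i| ≤ ∫ y in ball (x i) (8 * r i), |v y| ∂μ) ∧
      ∑ i ∈ s, |c i| ≤ ∫ y, |v y| ∂μ ∧ ∑ i ∈ s, c i = ∫ y, v y ∂μ := by
  have hD := h.D_pos
  set H : M → ℝ := fun y => ∑ i ∈ s, 2 * tent (x i) (8 * r i) y with hH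
  set φ : ι → M → ℝ := fun i y => 2 * tent (x i) (8 * r i) y / max 1 (H y) with hφ
  have hmax : ∀ y, 0 < max 1 (H y) := fun y => lt_max_of_lt_left one_pos
  have hHc : Continuous H := continuous_finsetSum _ fun i _ =>
    continuous_const.mul (continuous_tent _ _)
  have hφc : ∀ i, Continuous (φ i) := fun i =>
    (continuous_const.mul (continuous_tent _ _)).div (continuous_const.max hHc)
      fun y => (hmax y).ne'
  have hφ0 : ∀ i y, 0 ≤ φ i y := fun i y =>
    div_nonneg (mul_nonneg zero_le_two (tent_nonneg _ _ _)) (hmax y).le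
  have hφs : ∀ y, ∑ i ∈ s, φ i y = H y / max 1 (H y) := fun y => by
    simp only [hφ, hH, Finset.sum_div]
  have hφs1 : ∀ y, ∑ i ∈ s, φ i y ≤ 1 := fun y => by
    rw [hφs, div_le_one (hmax y)]; exact le_max_right _ _
  have hφ1 : ∀ i ∈ s, ∀ y, φ i y ≤ 1 := fun i hi y =>
    (Finset.single_le_sum (fun j _ => hφ0 j y) hi).trans (hφs1 y)
  have hφz : ∀ i ∈ s, ∀ y ∉ ball (x i) (8 * r i), φ i y = 0 := fun i hi y hy => by
    have := hr i hi
    simp only [hφ, tent_eq_zero (by positivity : 0 < 8 * r i) hy, mul_zero, zero_div]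
  have hvφ : ∀ y, ∑ i ∈ s, v y * φ i y = v y := fun y => by
    rw [← Finset.mul_sum]
    by_cases hy : v y = 0
    · simp [hy]
    · obtain ⟨i, hi, hyi⟩ := hvs y hy
      have hri := hr i hi
      have h1 : 1 ≤ H y := by
        refine le_trans ?_ (Finset.single_le_sum (f := fun i => 2 * tent (x i) (8 * r i) y)
          (fun j _ => mul_nonneg zero_le_two (tent_nonneg _ _ _)) hi)
        have : dist y (x i) / (8 * r i) ≤ 1 / 2 := by
          rw [div_le_iff₀ (by positivity)]
          have := mem_ball.1 hyi
          linarith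
        have : 1 / 2 ≤ tent (x i) (8 * r i) y := le_trans (by linarith) (le_max_right _ _)
        linarith
      rw [hφs, max_eq_right h1, div_self (by positivity), mul_one]
  have hle : ∀ i ∈ s, ∀ y, |v y * φ i y| ≤ |v y| := fun i hi y => by
    rw [abs_mul, abs_of_nonneg (hφ0 i y)]
    exact mul_le_of_le_one_right (abs_nonneg _) (hφ1 i hi y)
  have hint : ∀ i ∈ s, Integrable (fun y => v y * φ i y) μ := fun i hi =>
    hvi.mono (hv.mul (hφc i)).measurable.aestronglyMeasurable
      (ae_of_all _ fun y => by simpa using hle i hi y)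
  have habs : ∀ i ∈ s, |∫ y, v y * φ i y ∂μ| ≤ ∫ y in ball (x i) (8 * r i), |v y| ∂μ :=
    fun i hi => by
      rw [← setIntegral_eq_integral_of_forall_compl_eq_zero (s := ball (x i) (8 * r i))
        (fun y hy => by simp [hφz i hi y hy])]
      refine (abs_integral_le_integral_abs).trans ?_
      exact integral_mono (hint i hi).abs.integrableOn hvi.abs.integrableOn (hle i hi)
  refine ⟨fun i => ∫ y, v y * φ i y ∂μ, ?_, habs, ?_, ?_⟩
  · rw [Finset.mul_sum]
    refine (FinAtomic.sum (u := fun i y => v y * φ i y -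
      (∫ w, v w * φ i w ∂μ) * bump μ (x i) (r i) y) s fun i hi => ?_).congr fun y => ?_
    · have hri := hr i hi
      have hV := h.real_pos (x i) hri
      have h8 := h.real_eight (x i) hri
      have hm : |∫ y, v y * φ i y ∂μ| ≤ K * (D ^ 3 * μ.real (ball (x i) (r i))) := by
        refine (habs i hi).trans ?_
        calc ∫ y in ball (x i) (8 * r i), |v y| ∂μ ≤ ∫ y in ball (x i) (8 * r i), K ∂μ := by
              refine integral_mono hvi.abs.integrableOn ?_ hvK
              exact integrableOn_const (h.lt_top _ _ (by positivity)).ne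
          _ = K * μ.real (ball (x i) (8 * r i)) := by simp [mul_comm]
          _ ≤ _ := by gcongr
      refine (finAtomic_sub_bump h (hv.mul (hφc i)) (by positivity : 0 < 8 * r i) hri
        (ball_subset_ball (by linarith)) hK (fun y hy => ?_) (fun y => ?_) hm).mono (hS i hi) ?_
      · simp [hφz i hi y hy]
      · exact (hle i hi y).trans (hvK y)
      · calc _ = K * (1 + 2 * D * D ^ 3) * μ.real (ball (x i) (8 * r i)) := by field_simp
          _ ≤ K * (1 + 2 * D * D ^ 3) * (D ^ 3 * μ.real (ball (x i) (r i))) := by gcongr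
          _ = _ := by ring
    · rw [Finset.sum_sub_distrib, hvφ]
  · calc ∑ i ∈ s, |∫ y, v y * φ i y ∂μ| ≤ ∑ i ∈ s, ∫ y, |v y * φ i y| ∂μ :=
          Finset.sum_le_sum fun i _ => abs_integral_le_integral_abs
      _ = ∫ y, ∑ i ∈ s, |v y * φ i y| ∂μ :=
          (integral_finsetSum _ fun i hi => (hint i hi).abs).symm
      _ = ∫ y, |v y| ∂μ := by
          refine integral_congr_ae (ae_of_all _ fun y => ?_)
          have : ∑ i ∈ s, |v y * φ i y| = |v y| * ∑ i ∈ s, φ i y := by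
            rw [Finset.mul_sum]
            refine Finset.sum_congr rfl fun i _ => ?_
            rw [abs_mul, abs_of_nonneg (hφ0 i y)]
          simp only [this]
          have h2 := hvφ y
          rw [← Finset.mul_sum] at h2
          by_cases hy : v y = 0
          · simp [hy]
          · rw [mul_eq_left₀ hy] at h2
            rw [h2, mul_one]
  · rw [← integral_finsetSum _ hint]
    exact integral_congr_ae (ae_of_all _ hvφ)

end Spread

section Stopping

variable [BorelSpace M] {μ : Measure M} {D : ℝ}

omit [BorelSpace M] in
lemma uniformContinuous_sum_bump {ι : Type*} (s : Finset ι) (c : ι → ℝ) (x : ι → M) (r : ι → ℝ) :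
    UniformContinuous fun y => ∑ i ∈ s, c i * bump μ (x i) (r i) y := by
  classical
  induction s using Finset.induction_on with
  | empty => simpa using uniformContinuous_const
  | insert i s hi ih =>
    simp only [Finset.sum_insert hi]
    exact ((uniformContinuous_bump _ _).const_mul' _).add ih

lemma integral_sum_bump (h : BallDoubling μ D) {ι : Type*} (s : Finset ι) (c : ι → ℝ) {x : ι → M}
    {r : ι → ℝ} (hr : ∀ i ∈ s, 0 < r i) :
    Integrable (fun y => ∑ i ∈ s, c i * bump μ (x i) (r i) y) μ ∧
    ∫ y, ∑ i ∈ s, c i * bump μ (x i) (r i) y ∂μ = ∑ i ∈ s, c i ∧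
    ∫ y, |∑ i ∈ s, c i * bump μ (x i) (r i) y| ∂μ ≤ ∑ i ∈ s, |c i| := by
  have hi : ∀ i ∈ s, Integrable (fun y => c i * bump μ (x i) (r i) y) μ := fun i hi =>
    (integrable_bump h _ (hr i hi)).const_mul _
  have hsum := integrable_finsetSum s hi
  refine ⟨hsum, ?_, ?_⟩
  · rw [integral_finsetSum _ hi]
    refine Finset.sum_congr rfl fun i hi => ?_
    rw [integral_const_mul, integral_bump h _ (hr i hi), mul_one]
  · calc _ ≤ ∫ y, ∑ i ∈ s, |c i * bump μ (x i) (r i) y| ∂μ :=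
          integral_mono hsum.abs (integrable_finsetSum s fun i h' => (hi i h').abs)
            fun y => Finset.abs_sum_le_sum_abs _ _
      _ = ∑ i ∈ s, ∫ y, |c i| * bump μ (x i) (r i) y ∂μ := by
          rw [integral_finsetSum _ fun i h' => (hi i h').abs]
          simp only [abs_mul, abs_of_nonneg (bump_nonneg _ _ _)]
      _ = ∑ i ∈ s, |c i| := by
          refine Finset.sum_congr rfl fun i hi => ?_
          rw [integral_const_mul, integral_bump h _ (hr i hi), mul_one]

/-- One stopping-time step: at small cost, a function is replaced by one of size comparable with
the height `α`. -/
lemma exists_reduce_height (h : BallDoubling μ D) {x₀ : M} {ρ K m α : ℝ} (hρ : 0 < ρ) (hα : 0 < α)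
    (hm : m < α / 2 * μ.real (ball x₀ ρ)) {u : M → ℝ} (hu : UniformContinuous u)
    (hus : ∀ y ∉ ball x₀ ρ, u y = 0) (huK : ∀ y, |u y| ≤ K) (hum : ∫ y, |u y| ∂μ ≤ m) :
    ∃ u' : M → ℝ, UniformContinuous u' ∧ (∀ y ∉ ball x₀ (4 * ρ), u' y = 0) ∧
      (∀ y, |u' y| ≤ (1 + D ^ 4) * α) ∧ ∫ y, |u' y| ∂μ ≤ m ∧ ∫ y, u' y ∂μ = ∫ y, u y ∂μ ∧
      FinAtomic μ (ball x₀ (32 * ρ)) (K * (D ^ 3 * (1 + 2 * D * D ^ 3)) * (2 * m / α))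
        (fun y => u y - u' y) := by
  have hD := h.D_pos
  have hK : 0 ≤ K := (abs_nonneg _).trans (huK x₀)
  have hui : Integrable u μ :=
    h.integrable_of_bdd hu.continuous.measurable hρ hus (ae_of_all _ huK)
  set E : Set M := {y | α ≤ |u y|} with hE
  have hEsub : E ⊆ ball x₀ ρ := fun y hy => by
    by_contra hy'
    have : α ≤ |u y| := hy
    rw [hus y hy', abs_zero] at this
    linarith
  obtain ⟨t, ht, hut⟩ := Metric.uniformContinuous_iff.1 hu (α / 2) (by positivity)
  set P : M → ℕ → Prop := fun x j =>
    α / 2 * μ.real (ball x (t * 2 ^ j)) ≤ ∫ y in ball x (t * 2 ^ j), |u y| ∂μ with hP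
  have hP0 : ∀ x ∈ E, P x 0 := fun x hx => by
    have hx' : α ≤ |u x| := hx
    simp only [hP, pow_zero, mul_one]
    calc α / 2 * μ.real (ball x t) = ∫ y in ball x t, α / 2 ∂μ := by simp [mul_comm]
      _ ≤ _ := by
        refine setIntegral_mono_on (integrableOn_const (h.lt_top x t ht).ne)
          hui.abs.integrableOn measurableSet_ball fun y hy => ?_
        have h1 := hut (mem_ball.1 hy)
        rw [Real.dist_eq] at h1
        have h2 := abs_sub_abs_le_abs_sub (u x) (u y)
        rw [abs_sub_comm] at h2
        linarith
  have hPlt : ∀ x ∈ E, ∀ j, P x j → t * 2 ^ j < 2 * ρ := fun x hx j hj => by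
    by_contra! hcon
    have h1 : μ.real (ball x₀ ρ) ≤ μ.real (ball x (t * 2 ^ j)) := by
      refine h.real_mono (by positivity) (ball_subset_ball' ?_)
      have := mem_ball'.1 (hEsub hx)
      linarith
    have h2 : ∫ y in ball x (t * 2 ^ j), |u y| ∂μ ≤ m :=
      (setIntegral_le_integral hui.abs (ae_of_all _ fun y => abs_nonneg _)).trans hum
    have h3 : α / 2 * μ.real (ball x₀ ρ) ≤ α / 2 * μ.real (ball x (t * 2 ^ j)) := by gcongr
    have h4 : α / 2 * μ.real (ball x (t * 2 ^ j)) ≤ _ := hj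
    linarith
  obtain ⟨N, hN⟩ := pow_unbounded_of_one_lt (2 * ρ / t) one_lt_two
  rw [div_lt_iff₀ ht] at hN
  classical
  set J : M → ℕ := fun x => Nat.findGreatest (P x) N with hJ
  have hJP : ∀ x ∈ E, P x (J x) := fun x hx => Nat.findGreatest_spec (Nat.zero_le N) (hP0 x hx)
  have hJmax : ∀ x ∈ E, ∀ k, J x < k → ¬ P x k := fun x hx k hk hPk => by
    have h1 := hPlt x hx k hPk
    have h2 : k ≤ N := by
      by_contra! hcon
      have : (2 : ℝ) ^ N ≤ 2 ^ k := pow_le_pow_right₀ one_le_two hcon.le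
      have : t * 2 ^ N ≤ t * 2 ^ k := by gcongr
      linarith
    exact Nat.findGreatest_is_greatest hk h2 hPk
  set r : M → ℝ := fun x => t * 2 ^ J x with hr
  have hrpos : ∀ x, 0 < r x := fun x => by positivity
  have hrlt : ∀ x ∈ E, r x < 2 * ρ := fun x hx => hPlt x hx _ (hJP x hx)
  obtain ⟨s, hsE, hsd, hsc⟩ := h.exists_finset_cover hρ hEsub ht (r := r) (R := 2 * ρ)
    (fun x _ => by
      have : (1 : ℝ) ≤ 2 ^ J x := one_le_pow₀ one_le_two
      exact le_mul_of_one_le_right ht.le this)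
    (fun x hx => (hrlt x hx).le)
  set v : M → ℝ := fun y => u y - clamp α (u y) with hv
  have hcl : UniformContinuous fun y => clamp α (u y) := (uniformContinuous_clamp α).comp hu
  have hclz : ∀ y, u y = 0 → clamp α (u y) = 0 := fun y hy => by rw [hy, clamp_zero hα.le]
  have hcli : Integrable (fun y => clamp α (u y)) μ :=
    h.integrable_of_bdd hcl.continuous.measurable hρ (fun y hy => hclz y (hus y hy))
      (ae_of_all _ fun y => abs_clamp_le hα.le _)
  have hvu : ∀ y, |v y| ≤ |u y| := fun y => by
    have := abs_clamp_add_abs_sub_clamp hα.le (u y)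
    have := abs_nonneg (clamp α (u y))
    simp only [hv]; linarith
  have hvc : Continuous v := hu.continuous.sub hcl.continuous
  have hvi : Integrable v μ := hui.sub hcli
  obtain ⟨c, hat, hcb, hcs, hce⟩ := exists_spread h s (x := fun x => x) (r := r)
    (fun x _ => hrpos x) (S := ball x₀ (32 * ρ))
    (fun x hx => ball_subset_ball' (by
      have h1 := mem_ball.1 (hEsub (hsE hx)); have h2 := hrlt x (hsE hx); linarith))
    hvc hvi hK
    (fun y => (hvu y).trans (huK y)) (fun y hy => hsc y (by
      by_contra hcon
      have : |u y| < α := not_le.1 hcon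
      exact hy (by simp [hv, clamp_eq_self this.le])))
  have hcb' : ∀ x ∈ s, |c x| ≤ (α / 2 * D ^ 3) * μ.real (ball x (r x)) := fun x hx => by
    refine (hcb x hx).trans ?_
    have h1 := hJmax x (hsE hx) (J x + 3) (by omega)
    have h2 : t * 2 ^ (J x + 3) = 8 * r x := by simp only [hr]; ring
    simp only [hP, h2, not_le] at h1
    calc ∫ y in ball x (8 * r x), |u y - clamp α (u y)| ∂μ
        ≤ ∫ y in ball x (8 * r x), |u y| ∂μ :=
          integral_mono (hui.sub hcli).abs.integrableOn hui.abs.integrableOn hvu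
      _ ≤ α / 2 * μ.real (ball x (8 * r x)) := h1.le
      _ ≤ α / 2 * (D ^ 3 * μ.real (ball x (r x))) := by
          gcongr; exact h.real_eight x (hrpos x)
      _ = _ := by ring
  obtain ⟨hbi, hbe, hba⟩ := integral_sum_bump h s c (x := fun x => x) (r := r) fun x _ => hrpos x
  refine ⟨fun y => clamp α (u y) + ∑ x ∈ s, c x * bump μ x (r x) y,
    hcl.add (uniformContinuous_sum_bump s c (fun x => x) r), fun y hy => ?_,
    fun y => ?_, ?_, ?_, ?_⟩
  · show clamp α (u y) + ∑ x ∈ s, c x * bump μ x (r x) y = 0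
    rw [hclz y (hus y fun hy' => hy (ball_subset_ball (by linarith) hy')), zero_add]
    refine Finset.sum_eq_zero fun x hx => ?_
    rw [bump_eq_zero (hrpos x), mul_zero]
    refine fun hy' => hy (ball_subset_ball' ?_ hy')
    have h1 := mem_ball.1 (hEsub (hsE hx)); have h2 := hrlt x (hsE hx); linarith
  · refine (abs_add_le _ _).trans ?_
    have h1 := abs_clamp_le hα.le (u y)
    have h2 := abs_sum_bump_le h s (x := fun x => x) (fun x _ => hrpos x) hsd (by positivity) hcb' y
    calc _ ≤ α + 2 * D * (α / 2 * D ^ 3) := add_le_add h1 h2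
      _ = _ := by ring
  · calc _ ≤ ∫ y, |clamp α (u y)| + |∑ x ∈ s, c x * bump μ x (r x) y| ∂μ :=
          integral_mono (hcli.add hbi).abs (hcli.abs.add hbi.abs) fun y => abs_add_le _ _
      _ = ∫ y, |clamp α (u y)| ∂μ + ∫ y, |∑ x ∈ s, c x * bump μ x (r x) y| ∂μ :=
          integral_add hcli.abs hbi.abs
      _ ≤ ∫ y, |clamp α (u y)| ∂μ + ∫ y, |u y - clamp α (u y)| ∂μ := by
          exact add_le_add le_rfl (hba.trans hcs)
      _ = ∫ y, |u y| ∂μ := by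
          rw [← integral_add hcli.abs
            (show Integrable (fun y => |u y - clamp α (u y)|) μ from hvi.abs)]
          exact integral_congr_ae (ae_of_all _ fun y => abs_clamp_add_abs_sub_clamp hα.le (u y))
      _ ≤ m := hum
  · rw [integral_add hcli hbi, hbe, hce, ← integral_add hcli hvi]
    exact integral_congr_ae (ae_of_all _ fun y => by simp [hv])
  · refine (hat.mono subset_rfl ?_).congr fun y => by simp only [hv]; ring
    gcongr
    calc ∑ x ∈ s, μ.real (ball x (r x))
        ≤ ∑ x ∈ s, 2 / α * ∫ y in ball x (r x), |u y| ∂μ := by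
          refine Finset.sum_le_sum fun x hx => ?_
          have h1 : α / 2 * μ.real (ball x (r x)) ≤ _ := hJP x (hsE hx)
          rw [div_mul_eq_mul_div, le_div_iff₀ hα]
          linarith
      _ = 2 / α * ∑ x ∈ s, ∫ y in ball x (r x), |u y| ∂μ := by rw [Finset.mul_sum]
      _ ≤ 2 / α * m := by
          gcongr
          exact (sum_setIntegral_ball_le s (x := fun x => x) hsd hui).trans hum
      _ = 2 * m / α := by ring

end Stopping

section LLogL

variable [BorelSpace M] {μ : Measure M} {D : ℝ}

lemma finAtomic_bump_sub_bump (h : BallDoubling μ D) (x : M) {r : ℝ} (hr : 0 < r) :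
    FinAtomic μ (ball x (4 * r)) (2 * D + 2 * D * D ^ 2)
      (fun y => bump μ x (4 * r) y - bump μ x r y) := by
  have hD := h.D_pos
  have h4 : 0 < 4 * r := by positivity
  have hV := h.real_pos x hr
  have hV4 := h.real_pos x h4
  have hV' := h.real_four x hr
  have hI := integral_bump h x h4
  refine ((finAtomic_sub_bump h (continuous_bump x (4 * r)) h4 hr (ball_subset_ball (by linarith))
    (by positivity) (fun y hy => bump_eq_zero h4 hy) (abs_bump_le h x h4) (m := 1)
    (by rw [hI, abs_one])).mono subset_rfl ?_).congr fun y => ?_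
  · have h1 : μ.real (ball x (4 * r)) / μ.real (ball x r) ≤ D ^ 2 := by
      rwa [div_le_iff₀ hV]
    calc _ = 2 * D + 2 * D * (μ.real (ball x (4 * r)) / μ.real (ball x r)) := by field_simp
      _ ≤ _ := by gcongr
  · rw [hI, one_mul]

/-- The `L log L` estimate: a uniformly continuous function with mass `m` and height at most
`2 ^ s * m / V` has atomic norm `O((s + 1) * m)`, after subtracting its mean. -/
lemma exists_finAtomic_of_uniformContinuous (h : BallDoubling μ D) :
    ∃ C : ℝ, 0 < C ∧ ∀ (s : ℕ) (x₀ : M) (ρ K m : ℝ) (u : M → ℝ), 0 < ρ → 0 ≤ K → 0 < m →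
      UniformContinuous u → (∀ y ∉ ball x₀ ρ, u y = 0) → (∀ y, |u y| ≤ K) →
      ∫ y, |u y| ∂μ ≤ m → K * μ.real (ball x₀ ρ) ≤ 2 ^ s * m →
      FinAtomic μ (ball x₀ (32 * 4 ^ s * ρ)) (C * (s + 1) * m)
        (fun y => u y - (∫ w, u w ∂μ) * bump μ x₀ ρ y) := by
  have hD := h.D_pos
  have hD1 := h.one_le
  set c₁ := 4 * D ^ 2 * (1 + D ^ 4) + 2 * D with hc₁
  set c₂ := 2 * D ^ 2 * (1 + D ^ 4) * (D ^ 3 * (1 + 2 * D * D ^ 3)) * 2 with hc₂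
  set c₃ := 2 * D + 2 * D * D ^ 2 with hc₃
  have hp₁ : 0 < c₁ := by positivity
  have hp₂ : 0 < c₂ := by positivity
  have hp₃ : 0 < c₃ := by positivity
  refine ⟨c₁ + c₂ + c₃, by positivity, fun s => ?_⟩
  have key : ∀ (x₀ : M) (ρ K m : ℝ) (u : M → ℝ), 0 < ρ → 0 ≤ K → 0 < m →
      UniformContinuous u → (∀ y ∉ ball x₀ ρ, u y = 0) → (∀ y, |u y| ≤ K) →
      ∫ y, |u y| ∂μ ≤ m → K * μ.real (ball x₀ ρ) ≤ 4 * D ^ 2 * (1 + D ^ 4) * m → ∀ s : ℕ,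
      FinAtomic μ (ball x₀ (32 * 4 ^ s * ρ)) ((c₁ + c₂ + c₃) * (s + 1) * m)
        (fun y => u y - (∫ w, u w ∂μ) * bump μ x₀ ρ y) := by
    intro x₀ ρ K m u hρ hK hm hu hus huK hum hKV s
    have hV := h.real_pos x₀ hρ
    refine (finAtomic_sub_bump h hu.continuous hρ hρ subset_rfl hK hus huK
      (abs_integral_le_integral_abs.trans hum)).mono (ball_subset_ball ?_) ?_
    · have : (1 : ℝ) ≤ 4 ^ s := one_le_pow₀ (by norm_num)
      nlinarith
    · calc _ = K * μ.real (ball x₀ ρ) + 2 * D * m := by field_simp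
        _ ≤ c₁ * m := by rw [hc₁]; linarith
        _ ≤ (c₁ + c₂ + c₃) * (s + 1) * m := by
          gcongr
          have : (0 : ℝ) ≤ s := Nat.cast_nonneg s
          nlinarith
  induction s with
  | zero =>
    intro x₀ ρ K m u hρ hK hm hu hus huK hum hKV
    refine key x₀ ρ K m u hρ hK hm hu hus huK hum (hKV.trans ?_) 0
    rw [pow_zero]
    gcongr
    have : 1 ≤ D ^ 2 := one_le_pow₀ hD1
    have : 1 ≤ D ^ 4 := one_le_pow₀ hD1
    nlinarith
  | succ s ih =>
    intro x₀ ρ K m u hρ hK hm hu hus huK hum hKV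
    by_cases hcase : K * μ.real (ball x₀ ρ) ≤ 4 * D ^ 2 * (1 + D ^ 4) * m
    · exact key x₀ ρ K m u hρ hK hm hu hus huK hum hcase (s + 1)
    push Not at hcase
    have hV := h.real_pos x₀ hρ
    have hK' : 0 < K := by
      have : 0 < K * μ.real (ball x₀ ρ) := lt_trans (by positivity) hcase
      exact pos_of_mul_pos_left this hV.le
    set α := K / ((1 + D ^ 4) * (2 * D ^ 2)) with hα
    have hα0 : 0 < α := by positivity
    have hKα : (1 + D ^ 4) * α = K / (2 * D ^ 2) := by rw [hα]; field_simp
    have hmα : m < α / 2 * μ.real (ball x₀ ρ) := by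
      rw [hα, div_div, div_mul_eq_mul_div, lt_div_iff₀ (by positivity)]
      linarith
    obtain ⟨u', hu', hus', huK', hum', hue, hat⟩ :=
      exists_reduce_height h hρ hα0 hmα hu hus huK hum
    rw [hKα] at huK'
    have h4ρ : 0 < 4 * ρ := by positivity
    have h1 := ih x₀ (4 * ρ) (K / (2 * D ^ 2)) m u' h4ρ (by positivity) hm hu' hus' huK' hum' (by
      calc K / (2 * D ^ 2) * μ.real (ball x₀ (4 * ρ))
          ≤ K / (2 * D ^ 2) * (D ^ 2 * μ.real (ball x₀ ρ)) := by
            gcongr; exact h.real_four x₀ hρ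
        _ = K * μ.real (ball x₀ ρ) / 2 := by field_simp
        _ ≤ 2 ^ (s + 1) * m / 2 := by gcongr
        _ = 2 ^ s * m := by ring)
    rw [hue] at h1
    have h2 := (finAtomic_bump_sub_bump h x₀ hρ).smul (∫ w, u w ∂μ)
    have h4s : (1 : ℝ) ≤ 4 ^ s := one_le_pow₀ (by norm_num)
    have hr : 32 * 4 ^ s * (4 * ρ) = 32 * 4 ^ (s + 1) * ρ := by ring
    have h3 := ((hat.mono (ball_subset_ball (by rw [pow_succ]; nlinarith :
      32 * ρ ≤ 32 * 4 ^ (s + 1) * ρ)) le_rfl).add (h1.mono (ball_subset_ball hr.le) le_rfl)).add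
      (h2.mono (ball_subset_ball (by rw [pow_succ]; nlinarith :
      4 * ρ ≤ 32 * 4 ^ (s + 1) * ρ)) le_rfl)
    refine (h3.mono subset_rfl ?_).congr fun y => by ring
    have hI : |∫ w, u w ∂μ| ≤ m := abs_integral_le_integral_abs.trans hum
    have e1 : K * (D ^ 3 * (1 + 2 * D * D ^ 3)) * (2 * m / α) = c₂ * m := by
      rw [hα, hc₂]; field_simp
    rw [e1]
    have e2 : |∫ w, u w ∂μ| * (2 * D + 2 * D * D ^ 2) ≤ m * c₃ := by gcongr
    push_cast
    have := mul_pos hp₁ hm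
    nlinarith

end LLogL

section Approximation

variable [BorelSpace M] {μ : Measure M} {D : ℝ}

lemma BallDoubling.secondCountableTopology (h : BallDoubling μ D) : SecondCountableTopology M := by
  rcases isEmpty_or_nonempty M with hM | ⟨⟨x₀⟩⟩
  · infer_instance
  refine Metric.secondCountable_of_almost_dense_set fun ε hε => ?_
  have := fun n : ℕ => h.exists_finset_cover (x₀ := x₀) (E := ball x₀ (n + 1)) (ρ := n + 1)
    (t := ε / 4) (R := ε / 4) (r := fun _ => ε / 4) (by positivity) subset_rfl (by positivity)
    (fun _ _ => le_rfl) (fun _ _ => le_rfl)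
  choose s _ _ hs using this
  refine ⟨⋃ n, ↑(s n), countable_iUnion fun n => (s n).countable_toSet, fun x => ?_⟩
  obtain ⟨n, hn⟩ := exists_nat_gt (dist x x₀)
  obtain ⟨y, hy, hxy⟩ := hs n x (mem_ball.2 (by linarith))
  refine ⟨y, mem_iUnion.2 ⟨n, hy⟩, ?_⟩
  have := mem_ball.1 hxy
  linarith

omit [BorelSpace M] in
lemma BallDoubling.isLocallyFiniteMeasure (h : BallDoubling μ D) : IsLocallyFiniteMeasure μ :=
  ⟨fun x => ⟨ball x 1, ball_mem_nhds x one_pos, h.lt_top x 1 one_pos⟩⟩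

/-- A continuous function supported in a ball is uniformly continuous up to a finite combination of
atoms of small total mass. -/
lemma exists_uniformContinuous_approx [LocallyCompactSpace M] (h : BallDoubling μ D) {x₀ : M}
    {ρ K ε : ℝ} (hρ : 0 < ρ) (hε : 0 < ε) {u : M → ℝ} (hu : Continuous u)
    (hus : ∀ y ∉ ball x₀ ρ, u y = 0) (huK : ∀ y, |u y| ≤ K) :
    ∃ u' : M → ℝ, UniformContinuous u' ∧ (∀ y ∉ ball x₀ (2 * ρ), u' y = 0) ∧
      (∀ y, |u' y| ≤ (1 + 2 * D * D ^ 3) * K) ∧ ∫ y, |u' y| ∂μ ≤ ∫ y, |u y| ∂μ ∧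
      ∫ y, u' y ∂μ = ∫ y, u y ∂μ ∧ FinAtomic μ (ball x₀ (4 * ρ)) ε (fun y => u y - u' y) := by
  have := h.secondCountableTopology
  have := h.isLocallyFiniteMeasure
  have hD := h.D_pos
  have hK : 0 ≤ K := (abs_nonneg _).trans (huK x₀)
  have hui : Integrable u μ := h.integrable_of_bdd hu.measurable hρ hus (ae_of_all _ huK)
  set c₀ := K * (D ^ 3 * (1 + 2 * D * D ^ 3)) with hc₀
  have hc₀0 : 0 ≤ c₀ := by positivity
  have h2ρ : 0 < 2 * ρ := by positivity
  obtain ⟨F₀, hF₀A, hF₀, hF₀μ⟩ :=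
    (measurableSet_ball (x := x₀) (ε := 2 * ρ)).exists_isCompact_sdiff_lt
    (h.lt_top x₀ _ h2ρ).ne (ENNReal.ofReal_pos.2 (by positivity : 0 < ε / (c₀ + 1))).ne'
  set F := insert x₀ F₀ with hF
  have hFc : IsCompact F := hF₀.insert x₀
  have hFne : F.Nonempty := insert_nonempty _ _
  obtain ⟨δ, hδ, hFδ⟩ := hFc.exists_isCompact_cthickening
  have hFη : μ.real (ball x₀ (2 * ρ) \ F) ≤ ε / (c₀ + 1) := by
    refine ENNReal.toReal_le_of_le_ofReal (by positivity) (le_trans (measure_mono ?_) hF₀μ.le)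
    exact sdiff_subset_sdiff_right (subset_insert _ _)
  set χ : M → ℝ := fun y => max 0 (min 1 (2 - 2 * infDist y F / δ)) with hχ
  have hχc : Continuous χ := by
    have := continuous_infDist_pt F
    simp only [hχ]; fun_prop
  have hχ0 : ∀ y, 0 ≤ χ y := fun y => le_max_left _ _
  have hχ1 : ∀ y, χ y ≤ 1 := fun y => max_le zero_le_one (min_le_left _ _)
  have hχF : ∀ y, infDist y F ≤ δ / 2 → χ y = 1 := fun y hy => by
    have : 2 * infDist y F / δ ≤ 1 := by rw [div_le_one hδ]; linarith
    simp only [hχ]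
    rw [min_eq_left (by linarith), max_eq_right zero_le_one]
  have hχz : ∀ y ∉ cthickening δ F, χ y = 0 := fun y hy => by
    have h1 : δ ≤ infDist y F := by
      by_contra! hcon
      exact hy (thickening_subset_cthickening _ _ ((mem_thickening_iff_infDist_lt hFne).2 hcon))
    have : 1 ≤ infDist y F / δ := by rwa [one_le_div hδ]
    simp only [hχ]
    rw [mul_div_assoc, max_eq_left]
    exact (min_le_right _ _).trans (by linarith)
  have hwc : Continuous fun y => u y * χ y := hu.mul hχc
  have hw : UniformContinuous fun y => u y * χ y :=
    HasCompactSupport.uniformContinuous_of_continuous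
      (HasCompactSupport.intro hFδ fun y hy => by rw [hχz y hy, mul_zero]) hwc
  set v : M → ℝ := fun y => u y * (1 - χ y) with hv
  have hvc : Continuous v := hu.mul (continuous_const.sub hχc)
  have hvu : ∀ y, |v y| ≤ |u y| := fun y => by
    simp only [hv, abs_mul]
    refine mul_le_of_le_one_right (abs_nonneg _) ?_
    rw [abs_of_nonneg (by linarith [hχ1 y])]
    linarith [hχ0 y]
  have hvi : Integrable v μ := hui.mono hvc.measurable.aestronglyMeasurable (ae_of_all _ hvu)
  have hwu : ∀ y, |u y * χ y| ≤ |u y| := fun y => by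
    rw [abs_mul, abs_of_nonneg (hχ0 y)]
    exact mul_le_of_le_one_right (abs_nonneg _) (hχ1 y)
  have hwi : Integrable (fun y => u y * χ y) μ :=
    hui.mono hwc.measurable.aestronglyMeasurable (ae_of_all _ hwu)
  have hsplit : ∀ y, |u y * χ y| + |v y| = |u y| := fun y => by
    simp only [hv, abs_mul]
    rw [abs_of_nonneg (hχ0 y), abs_of_nonneg (by linarith [hχ1 y] : 0 ≤ 1 - χ y)]
    ring
  set E : Set M := {y | v y ≠ 0} with hE
  have hEsub : E ⊆ ball x₀ ρ := fun y hy => by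
    by_contra hy'
    exact hy (by simp only [hv, hus y hy', zero_mul])
  have hEF : ∀ y ∈ E, δ / 2 < infDist y F := fun y hy => by
    by_contra! hcon
    exact hy (by simp only [hv, hχF y hcon, sub_self, mul_zero])
  set t := min (δ / 2) (ρ / 4) with ht
  have ht0 : 0 < t := by positivity
  have htδ : t ≤ δ / 2 := min_le_left _ _
  have htρ : t ≤ ρ / 4 := min_le_right _ _
  obtain ⟨s, hsE, hsd, hsc⟩ := h.exists_finset_cover hρ hEsub ht0 (r := fun _ => t) (R := t)
    (fun _ _ => le_rfl) (fun _ _ => le_rfl)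
  have hsball : ∀ x ∈ s, dist x x₀ < ρ := fun x hx => hEsub (hsE hx)
  have hsV : ∑ x ∈ s, μ.real (ball x t) ≤ ε / (c₀ + 1) := by
    refine le_trans (sum_real_ball_le s (x := fun x => x) hsd
      ((measure_mono sdiff_subset).trans_lt (h.lt_top x₀ _ h2ρ)).ne fun x hx y hy => ⟨?_, ?_⟩) hFη
    · exact ball_subset_ball' (by have := hsball x hx; linarith) hy
    · intro hyF
      have h1 := infDist_le_dist_of_mem (x := x) hyF
      have h2 := hEF x (hsE hx)
      have h3 := mem_ball'.1 hy
      linarith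
  obtain ⟨c, hat, hcb, hcs, hce⟩ := exists_spread h s (x := fun x => x) (r := fun _ => t)
    (fun _ _ => ht0) (S := ball x₀ (4 * ρ))
    (fun x hx => ball_subset_ball' (by have := hsball x hx; linarith))
    hvc hvi hK (fun y => (hvu y).trans (huK y)) (fun y hy => hsc y hy)
  have hcb' : ∀ x ∈ s, |c x| ≤ (K * D ^ 3) * μ.real (ball x t) := fun x hx => by
    refine (hcb x hx).trans ?_
    calc ∫ y in ball x (8 * t), |v y| ∂μ ≤ ∫ y in ball x (8 * t), K ∂μ := by
          refine integral_mono hvi.abs.integrableOn ?_ fun y => (hvu y).trans (huK y)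
          exact integrableOn_const (h.lt_top _ _ (by positivity)).ne
      _ = K * μ.real (ball x (8 * t)) := by simp [mul_comm]
      _ ≤ K * (D ^ 3 * μ.real (ball x t)) := by gcongr; exact h.real_eight x ht0
      _ = _ := by ring
  obtain ⟨hbi, hbe, hba⟩ := integral_sum_bump h s c (x := fun x => x) (r := fun _ => t)
    fun _ _ => ht0
  refine ⟨fun y => u y * χ y + ∑ x ∈ s, c x * bump μ x t y,
    hw.add (uniformContinuous_sum_bump s c (fun x => x) _), fun y hy => ?_, fun y => ?_, ?_, ?_, ?_⟩
  · show u y * χ y + ∑ x ∈ s, c x * bump μ x t y = 0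
    rw [hus y fun hy' => hy (ball_subset_ball (by linarith) hy'), zero_mul, zero_add]
    refine Finset.sum_eq_zero fun x hx => ?_
    rw [bump_eq_zero ht0, mul_zero]
    exact fun hy' => hy (ball_subset_ball' (by have := hsball x hx; linarith) hy')
  · refine (abs_add_le _ _).trans ?_
    have h1 := (hwu y).trans (huK y)
    have h2 := abs_sum_bump_le h s (x := fun x => x) (fun _ _ => ht0) hsd (by positivity) hcb' y
    calc _ ≤ K + 2 * D * (K * D ^ 3) := add_le_add h1 h2
      _ = _ := by ring
  · calc _ ≤ ∫ y, |u y * χ y| + |∑ x ∈ s, c x * bump μ x t y| ∂μ :=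
          integral_mono (hwi.add hbi).abs (hwi.abs.add hbi.abs) fun y => abs_add_le _ _
      _ = ∫ y, |u y * χ y| ∂μ + ∫ y, |∑ x ∈ s, c x * bump μ x t y| ∂μ :=
          integral_add hwi.abs hbi.abs
      _ ≤ ∫ y, |u y * χ y| ∂μ + ∫ y, |v y| ∂μ := add_le_add le_rfl (hba.trans hcs)
      _ = ∫ y, |u y| ∂μ := by
          rw [← integral_add hwi.abs hvi.abs]
          exact integral_congr_ae (ae_of_all _ hsplit)
  · rw [integral_add hwi hbi, hbe, hce, ← integral_add hwi hvi]
    exact integral_congr_ae (ae_of_all _ fun y => by simp only [hv]; ring)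
  · refine (hat.mono subset_rfl ?_).congr fun y => by simp only [hv]; ring
    calc c₀ * ∑ x ∈ s, μ.real (ball x t) ≤ c₀ * (ε / (c₀ + 1)) := by gcongr
      _ ≤ ε := by
        rw [← mul_div_assoc, div_le_iff₀ (by positivity)]
        nlinarith

end Approximation

section SquareIntegrable

variable [BorelSpace M] {μ : Measure M} {D : ℝ}

/-- The `L log L` estimate for continuous functions. -/
lemma exists_finAtomic_of_continuous [LocallyCompactSpace M] (h : BallDoubling μ D) :
    ∃ C : ℝ, 0 < C ∧ ∃ R : ℕ → ℝ, ∀ (s : ℕ) (x₀ : M) (ρ K m : ℝ) (u : M → ℝ), 0 < ρ → 0 < m →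
      Continuous u → (∀ y ∉ ball x₀ ρ, u y = 0) → (∀ y, |u y| ≤ K) →
      ∫ y, |u y| ∂μ ≤ m → K * μ.real (ball x₀ ρ) ≤ 2 ^ s * m →
      FinAtomic μ (ball x₀ (R s * ρ)) (C * (s + 1) * m)
        (fun y => u y - (∫ w, u w ∂μ) * bump μ x₀ ρ y) := by
  have hD := h.D_pos
  obtain ⟨C, hC, hA⟩ := exists_finAtomic_of_uniformContinuous h
  obtain ⟨p, hp⟩ := pow_unbounded_of_one_lt ((1 + 2 * D * D ^ 3) * D ^ 2) one_lt_two
  refine ⟨C * (p + 1) + (1 + (2 * D + 2 * D * D ^ 2)), by positivity,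
    fun s => 32 * 4 ^ (s + p) * 4, fun s x₀ ρ K m u hρ hm hu hus huK hum hKV => ?_⟩
  have hK : 0 ≤ K := (abs_nonneg _).trans (huK x₀)
  have hV := h.real_pos x₀ hρ
  obtain ⟨u', hu', hus', huK', hum', hue, hat⟩ :=
    exists_uniformContinuous_approx h hρ hm hu hus huK
  have h4ρ : 0 < 4 * ρ := by positivity
  have h1 := hA (s + p) x₀ (4 * ρ) ((1 + 2 * D * D ^ 3) * K) m u' h4ρ (by positivity) hm hu'
    (fun y hy => hus' y fun hy' => hy (ball_subset_ball (by linarith) hy')) huK'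
    (hum'.trans hum) (by
      calc (1 + 2 * D * D ^ 3) * K * μ.real (ball x₀ (4 * ρ))
          ≤ (1 + 2 * D * D ^ 3) * K * (D ^ 2 * μ.real (ball x₀ ρ)) := by
            gcongr; exact h.real_four x₀ hρ
        _ = ((1 + 2 * D * D ^ 3) * D ^ 2) * (K * μ.real (ball x₀ ρ)) := by ring
        _ ≤ 2 ^ p * (2 ^ s * m) := by gcongr
        _ = 2 ^ (s + p) * m := by ring)
  rw [hue] at h1
  have h2 := (finAtomic_bump_sub_bump h x₀ hρ).smul (∫ w, u w ∂μ)
  have h4s : (1 : ℝ) ≤ 4 ^ (s + p) := one_le_pow₀ (by norm_num)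
  have hsub : ball x₀ (4 * ρ) ⊆ ball x₀ (32 * 4 ^ (s + p) * 4 * ρ) :=
    ball_subset_ball (by nlinarith)
  have h3 := ((hat.mono hsub le_rfl).add (h1.mono (ball_subset_ball
    (by linarith : 32 * 4 ^ (s + p) * (4 * ρ) ≤ 32 * 4 ^ (s + p) * 4 * ρ)) le_rfl)).add
    (h2.mono hsub le_rfl)
  refine (h3.mono subset_rfl ?_).congr fun y => by ring
  have hI : |∫ w, u w ∂μ| ≤ m := abs_integral_le_integral_abs.trans hum
  have e2 : |∫ w, u w ∂μ| * (2 * D + 2 * D * D ^ 2) ≤ m * (2 * D + 2 * D * D ^ 2) := by gcongr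
  have hs : (0 : ℝ) ≤ s := Nat.cast_nonneg s
  have hp0 : (0 : ℝ) ≤ p := Nat.cast_nonneg p
  have e3 : C * m * (s + p + 1) ≤ C * m * ((p + 1) * (s + 1)) := by
    gcongr; nlinarith
  have e4 : (1 + (2 * D + 2 * D * D ^ 2)) * m * 1 ≤
      (1 + (2 * D + 2 * D * D ^ 2)) * m * (s + 1) := by
    gcongr; linarith
  push_cast
  linarith

omit [MetricSpace M] [MeasurableSpace M] [BorelSpace M] in
lemma abs_clamp_two_mul_sub_clamp_le {a : ℝ} (ha : 0 < a) (t : ℝ) :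
    |clamp (2 * a) t - clamp a t| ≤ 2 / a * t ^ 2 := by
  rcases le_or_gt |t| a with hta | hta
  · rw [clamp_eq_self hta, clamp_eq_self (hta.trans (by linarith)), sub_self, abs_zero]
    positivity
  · have h1 := abs_sub (clamp (2 * a) t) (clamp a t)
    have h2 := abs_clamp_le_abs (by positivity : 0 ≤ 2 * a) t
    have h3 := abs_clamp_le_abs ha.le t
    have h4 : |t| ≤ t ^ 2 / a := by
      rw [le_div_iff₀ ha, ← sq_abs, sq]
      gcongr
    calc _ ≤ 2 * |t| := by linarith
      _ ≤ 2 * (t ^ 2 / a) := by gcongr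
      _ = _ := by ring

/-- Continuous mean-zero functions on a fixed ball have finite-atomic norm controlled by their
`L²` norm. -/
lemma exists_finAtomic_of_integral_sq_le_one [LocallyCompactSpace M] (h : BallDoubling μ D) (x₀ : M)
    {ρ : ℝ} (hρ : 0 < ρ) :
    ∃ C : ℝ, 0 < C ∧ ∀ (L : ℝ) (e : M → ℝ), Continuous e → (∀ y ∉ ball x₀ ρ, e y = 0) →
      (∀ y, |e y| ≤ L) → ∫ y, e y ∂μ = 0 → ∫ y, e y ^ 2 ∂μ ≤ 1 → FinAtomic μ univ C e := by
  have hV := h.real_pos x₀ hρ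
  obtain ⟨C, hC, R, hA⟩ := exists_finAtomic_of_continuous h
  obtain ⟨q, hq⟩ := pow_unbounded_of_one_lt (μ.real (ball x₀ ρ)) one_lt_two
  refine ⟨C * μ.real (ball x₀ ρ) + 2 * C * (2 * q + 8), by positivity,
    fun L e he hes heL he0 he2 => ?_⟩
  have hcl : ∀ j : ℕ, Continuous fun y => clamp (2 ^ j) (e y) := fun j =>
    (continuous_clamp _).comp he
  have hclz : ∀ (j : ℕ), ∀ y ∉ ball x₀ ρ, clamp (2 ^ j) (e y) = 0 := fun j y hy => by
    rw [hes y hy, clamp_zero (by positivity)]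
  have hclb : ∀ (j : ℕ) y, |clamp (2 ^ j) (e y)| ≤ 2 ^ j := fun j y =>
    abs_clamp_le (by positivity) _
  have hcli : ∀ j : ℕ, Integrable (fun y => clamp (2 ^ j) (e y)) μ := fun j =>
    h.integrable_of_bdd (hcl j).measurable hρ (hclz j) (ae_of_all _ (hclb j))
  have hei : Integrable (fun y => e y ^ 2) μ :=
    h.integrable_of_bdd (he.pow 2).measurable hρ (K := L ^ 2)
      (fun y hy => by rw [hes y hy, zero_pow two_ne_zero])
      (ae_of_all _ fun y => by
        rw [abs_pow]; exact pow_le_pow_left₀ (abs_nonneg _) (heL y) 2)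
  have h0 : FinAtomic μ univ (C * μ.real (ball x₀ ρ)) (fun y => clamp (2 ^ 0) (e y) -
      (∫ w, clamp (2 ^ 0) (e w) ∂μ) * bump μ x₀ ρ y) := by
    refine (hA 0 x₀ ρ 1 (μ.real (ball x₀ ρ)) _ hρ hV (hcl 0) (hclz 0)
      (fun y => (hclb 0 y).trans_eq (pow_zero 2)) ?_ (by simp)).mono (subset_univ _) (by simp)
    refine (h.integral_abs_le (hcl 0).measurable hρ (hclz 0) (ae_of_all _ (hclb 0))).trans ?_
    simp
  have hj : ∀ j : ℕ, FinAtomic μ univ (C * (2 * j + q + 2) * (2 / 2 ^ j))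
      (fun y => (clamp (2 ^ (j + 1)) (e y) - clamp (2 ^ j) (e y)) -
        (∫ w, (clamp (2 ^ (j + 1)) (e w) - clamp (2 ^ j) (e w)) ∂μ) * bump μ x₀ ρ y) := by
    intro j
    have hdi := (hcli (j + 1)).sub (hcli j)
    refine (hA (2 * j + q + 1) x₀ ρ (2 ^ (j + 2)) (2 / 2 ^ j) _ hρ (by positivity)
      ((hcl (j + 1)).sub (hcl j)) (fun y hy => ?_) (fun y => ?_) ?_ ?_).mono (subset_univ _) ?_
    · show clamp (2 ^ (j + 1)) (e y) - clamp (2 ^ j) (e y) = 0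
      rw [hclz _ y hy, hclz _ y hy, sub_zero]
    · have h1 := abs_sub (clamp (2 ^ (j + 1)) (e y)) (clamp (2 ^ j) (e y))
      have h2 := hclb (j + 1) y
      have h3 := hclb j y
      have : (0 : ℝ) < 2 ^ j := by positivity
      show |clamp (2 ^ (j + 1)) (e y) - clamp (2 ^ j) (e y)| ≤ _
      rw [pow_succ] at *
      linarith [pow_succ (2 : ℝ) j, pow_succ (2 : ℝ) (j + 1)]
    · calc ∫ y, |clamp (2 ^ (j + 1)) (e y) - clamp (2 ^ j) (e y)| ∂μ
          ≤ ∫ y, 2 / 2 ^ j * e y ^ 2 ∂μ := by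
            refine integral_mono hdi.abs (hei.const_mul _) fun y => ?_
            have := abs_clamp_two_mul_sub_clamp_le (by positivity : (0 : ℝ) < 2 ^ j) (e y)
            rwa [← pow_succ'] at this
        _ = 2 / 2 ^ j * ∫ y, e y ^ 2 ∂μ := integral_const_mul _ _
        _ ≤ 2 / 2 ^ j * 1 := by gcongr
        _ = _ := mul_one _
    · calc (2 : ℝ) ^ (j + 2) * μ.real (ball x₀ ρ) ≤ 2 ^ (j + 2) * 2 ^ q := by gcongr
        _ = 2 ^ (2 * j + q + 1) * (2 / 2 ^ j) := by
          rw [mul_div_assoc', eq_div_iff (by positivity)]; ring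
    · push_cast
      exact le_of_eq (by ring)
  obtain ⟨J, hJ⟩ := pow_unbounded_of_one_lt L one_lt_two
  have heJ : ∀ y, clamp (2 ^ J) (e y) = e y := fun y => clamp_eq_self ((heL y).trans hJ.le)
  refine ((h0.add (FinAtomic.sum (Finset.range J) fun j _ => hj j)).mono subset_rfl ?_).congr
    fun y => ?_
  · have hsum : ∀ J : ℕ, ∑ j ∈ Finset.range J, C * (2 * j + q + 2) * (2 / 2 ^ j) =
        2 * C * ((2 * q + 8) - (4 * J + 2 * q + 8) / 2 ^ J) := by
      intro J
      induction J with
      | zero => simp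
      | succ J ih =>
        rw [Finset.sum_range_succ, ih]
        push_cast
        field_simp
        ring
    rw [hsum]
    have : (0 : ℝ) ≤ (4 * J + 2 * q + 8) / 2 ^ J := by positivity
    have : 2 * C * ((2 * q + 8) - (4 * J + 2 * q + 8) / 2 ^ J) ≤ 2 * C * (2 * q + 8) := by
      gcongr; linarith
    linarith
  · have e1 : ∑ j ∈ Finset.range J, (clamp (2 ^ (j + 1)) (e y) - clamp (2 ^ j) (e y)) =
        e y - clamp (2 ^ 0) (e y) := by
      rw [Finset.sum_range_sub (fun j => clamp (2 ^ j) (e y)), heJ]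
    have e2 : ∑ j ∈ Finset.range J, ∫ w, (clamp (2 ^ (j + 1)) (e w) - clamp (2 ^ j) (e w)) ∂μ =
        - ∫ w, clamp (2 ^ 0) (e w) ∂μ := by
      have : ∀ j ∈ Finset.range J, ∫ w, (clamp (2 ^ (j + 1)) (e w) - clamp (2 ^ j) (e w)) ∂μ =
          ∫ w, clamp (2 ^ (j + 1)) (e w) ∂μ - ∫ w, clamp (2 ^ j) (e w) ∂μ := fun j _ =>
        integral_sub (hcli (j + 1)) (hcli j)
      rw [Finset.sum_congr rfl this, Finset.sum_range_sub (fun j => ∫ w, clamp (2 ^ j) (e w) ∂μ)]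
      simp only [heJ, he0, zero_sub]
    rw [Finset.sum_sub_distrib, ← Finset.sum_mul, e1, e2]
    ring

lemma exists_finAtomic_of_integral_sq_le [LocallyCompactSpace M] (h : BallDoubling μ D) (x₀ : M)
    {ρ ε : ℝ} (hρ : 0 < ρ) (hε : 0 < ε) :
    ∃ δ : ℝ, 0 < δ ∧ ∀ (L : ℝ) (e : M → ℝ), Continuous e → (∀ y ∉ ball x₀ ρ, e y = 0) →
      (∀ y, |e y| ≤ L) → ∫ y, e y ∂μ = 0 → ∫ y, e y ^ 2 ∂μ ≤ δ → FinAtomic μ univ ε e := by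
  obtain ⟨C, hC, hB⟩ := exists_finAtomic_of_integral_sq_le_one h x₀ hρ
  refine ⟨(ε / C) ^ 2, by positivity, fun L e he hes heL he0 he2 => ?_⟩
  have h1 := hB (C / ε * L) (fun y => C / ε * e y) (continuous_const.mul he)
    (fun y hy => by rw [hes y hy, mul_zero])
    (fun y => by rw [abs_mul, abs_of_pos (by positivity : 0 < C / ε)]; gcongr; exact heL y)
    (by rw [integral_const_mul, he0, mul_zero])
    (by
      simp only [mul_pow]
      rw [integral_const_mul]
      calc _ ≤ (C / ε) ^ 2 * (ε / C) ^ 2 := by gcongr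
        _ = 1 := by field_simp)
  refine ((h1.smul (ε / C)).mono subset_rfl ?_).congr fun y => by field_simp
  rw [abs_of_pos (by positivity)]
  exact le_of_eq (by field_simp)

end SquareIntegrable

section Density

variable [BorelSpace M] {μ : Measure M} {D : ℝ}

/-- Density of continuous functions supported in a ball, with respect to a weight. -/
lemma exists_continuous_approx (h : BallDoubling μ D) {x : M} {ρ ε : ℝ} (hρ : 0 < ρ) (hε : 0 < ε)
    {b g₀ : M → ℝ} (hb : Measurable b) (hbi : IntegrableOn b (ball x ρ) μ) (hg₀ : Measurable g₀)
    (hg₀1 : ∀ y, |g₀ y| ≤ 1) :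
    ∃ g : M → ℝ, Continuous g ∧ (∀ y, |g y| ≤ 1) ∧ (∀ y ∉ ball x ρ, g y = 0) ∧
      ∫ y in ball x ρ, (1 + |b y|) * |g y - g₀ y| ∂μ ≤ ε := by
  set w : M → NNReal := fun y => 1 + ‖b y‖₊ with hw
  have hwm : Measurable w := measurable_const.add hb.nnnorm
  have hwi : Integrable (fun y => 1 + |b y|) (μ.restrict (ball x ρ)) :=
    (integrableOn_const (h.lt_top x ρ hρ).ne).add hbi.abs
  set ν := (μ.restrict (ball x ρ)).withDensity fun y => (w y : ENNReal) with hν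
  have hint : ∀ f : M → ℝ, ∫ y, f y ∂ν = ∫ y in ball x ρ, (1 + |b y|) * f y ∂μ := fun f => by
    rw [hν, integral_withDensity_eq_integral_smul hwm]
    rfl
  have : IsFiniteMeasure ν := by
    refine isFiniteMeasure_withDensity ?_
    have := hwi.2
    rw [hasFiniteIntegral_iff_enorm] at this
    refine ne_of_lt (lt_of_le_of_lt (lintegral_mono fun y => ?_) this)
    rw [Real.enorm_eq_ofReal_abs, ← ENNReal.ofReal_coe_nnreal]
    refine ENNReal.ofReal_le_ofReal ((le_abs_self _).trans' ?_)
    simp [hw]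
  have hfin : ∀ f : M → ℝ, Measurable f → (∀ y, |f y| ≤ 1) → Integrable f ν := fun f hf hf1 =>
    Integrable.of_bound hf.aestronglyMeasurable 1 (ae_of_all _ hf1)
  obtain ⟨g, hg, -⟩ := (hfin g₀ hg₀ hg₀1).exists_boundedContinuous_integral_sub_le (half_pos hε)
  set g₁ : M → ℝ := fun y => clamp 1 (g y) with hg₁
  have hg₁c : Continuous g₁ := (continuous_clamp 1).comp g.continuous
  have hg₁1 : ∀ y, |g₁ y| ≤ 1 := fun y => abs_clamp_le zero_le_one _
  have hle : ∀ y, |g₁ y - g₀ y| ≤ ‖g₀ y - g y‖ := fun y => by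
    have := abs_clamp_sub_clamp_le 1 (g y) (g₀ y)
    rw [clamp_eq_self (hg₀1 y)] at this
    rwa [Real.norm_eq_abs, abs_sub_comm (g₀ y)]
  have hi1 := ((hfin g₁ hg₁c.measurable hg₁1).sub (hfin g₀ hg₀ hg₀1)).abs
  have hgε : ∫ y, |g₁ y - g₀ y| ∂ν ≤ ε / 2 :=
    (integral_mono hi1 ((hfin g₀ hg₀ hg₀1).sub (g.integrable ν)).norm hle).trans hg
  set χ : ℕ → M → ℝ := fun n y => min 1 (n * max 0 (ρ - dist y x)) with hχ
  have hχc : ∀ n, Continuous (χ n) := fun n => by simp only [hχ]; fun_prop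
  have hχ0 : ∀ n y, 0 ≤ χ n y := fun n y =>
    le_min zero_le_one (mul_nonneg (Nat.cast_nonneg n) (le_max_left _ _))
  have hχ1 : ∀ n y, χ n y ≤ 1 := fun n y => min_le_left _ _
  have hg2 : ∀ n y, |g₁ y * χ n y| ≤ 1 := fun n y => by
    rw [abs_mul, abs_of_nonneg (hχ0 n y)]
    exact mul_le_one₀ (hg₁1 y) (hχ0 n y) (hχ1 n y)
  have hball : ∀ᵐ y ∂ν, y ∈ ball x ρ :=
    (withDensity_absolutelyContinuous _ _).ae_le (ae_restrict_mem measurableSet_ball)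
  have hlim : Tendsto (fun n => ∫ y, |g₁ y * χ n y - g₀ y| ∂ν) atTop
      (nhds (∫ y, |g₁ y - g₀ y| ∂ν)) := by
    refine tendsto_integral_of_dominated_convergence (fun _ => 2)
      (fun n => ((hg₁c.mul (hχc n)).measurable.sub hg₀).aestronglyMeasurable.norm)
      (integrable_const 2) (fun n => ae_of_all _ fun y => ?_) ?_
    · rw [Real.norm_eq_abs, abs_abs]
      have := abs_sub (g₁ y * χ n y) (g₀ y)
      linarith [hg2 n y, hg₀1 y]
    · filter_upwards [hball] with y hy
      refine tendsto_const_nhds.congr' ?_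
      have hpos : 0 < max 0 (ρ - dist y x) := lt_max_of_lt_right (by
        have := mem_ball.1 hy; linarith)
      obtain ⟨N, hN⟩ := exists_nat_gt (1 / max 0 (ρ - dist y x))
      rw [div_lt_iff₀ hpos] at hN
      filter_upwards [eventually_ge_atTop N] with n hn
      have h1 : (N : ℝ) * max 0 (ρ - dist y x) ≤ n * max 0 (ρ - dist y x) := by gcongr
      simp only [hχ]
      rw [min_eq_left (by linarith), mul_one]
  obtain ⟨n, hn⟩ := (hlim.eventually (gt_mem_nhds (by linarith :
    ∫ y, |g₁ y - g₀ y| ∂ν < ε))).exists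
  refine ⟨fun y => g₁ y * χ n y, hg₁c.mul (hχc n), hg2 n, fun y hy => ?_, ?_⟩
  · have : ρ - dist y x ≤ 0 := by
      have := not_lt.1 (mt mem_ball.2 hy); linarith
    simp [hχ, max_eq_left this]
  · rw [← hint]
    exact hn.le

/-- A function whose pairings with finite combinations of continuous atoms are bounded by their
cost has bounded mean oscillation, with exponential decay over small sets. -/
lemma exists_setIntegral_abs_sub_le [LocallyCompactSpace M] (h : BallDoubling μ D) :
    ∃ C : ℝ, 0 < C ∧ ∃ R : ℕ → ℝ, ∀ (s : ℕ) (x : M) (ρ : ℝ) (b : M → ℝ) (E : Set M), 0 < ρ →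
      Measurable b → (∀ r, IntegrableOn b (ball x r) μ) →
      (∀ t g, FinAtomic μ (ball x (R s * ρ)) t g → |∫ y, b y * g y ∂μ| ≤ t) →
      MeasurableSet E → E ⊆ ball x ρ → 2 ^ s * μ.real E ≤ μ.real (ball x ρ) →
      2 ^ s * ∫ y in E, |b y - ∫ w, b w * bump μ x ρ w ∂μ| ∂μ ≤
        C * (s + 1) * μ.real (ball x ρ) := by
  obtain ⟨C, hC, R, hA⟩ := exists_finAtomic_of_continuous h
  refine ⟨2 * C + 1, by positivity, R, fun s x ρ b E hρ hb hbi hbT hE hEs hEV => ?_⟩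
  have hV := h.real_pos x hρ
  set B := ball x ρ with hB
  have hBtop : μ B ≠ ⊤ := (h.lt_top x ρ hρ).ne
  have hBm : MeasurableSet B := measurableSet_ball
  set c := ∫ w, b w * bump μ x ρ w ∂μ with hc
  set d : M → ℝ := fun y => b y - c with hd
  have hdm : Measurable d := hb.sub measurable_const
  have hdi : IntegrableOn d B μ := (hbi ρ).sub (integrableOn_const hBtop)
  set σ : M → ℝ := fun y => if 0 ≤ d y then 1 else -1 with hσ
  have hσm : Measurable σ :=
    Measurable.ite (measurableSet_le measurable_const hdm) measurable_const measurable_const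
  have hσd : ∀ y, d y * σ y = |d y| := fun y => by
    simp only [hσ]
    split_ifs with hy
    · rw [abs_of_nonneg hy, mul_one]
    · rw [abs_of_neg (not_le.1 hy)]; ring
  have hσ1 : ∀ y, |σ y| = 1 := fun y => by simp only [hσ]; split_ifs <;> simp
  set g₀ : M → ℝ := E.indicator σ with hg₀
  have hg₀m : Measurable g₀ := hσm.indicator hE
  have hg₀1 : ∀ y, |g₀ y| ≤ 1 := fun y => by
    by_cases hy : y ∈ E
    · simp only [hg₀, indicator_of_mem hy, hσ1, le_refl]
    · simp only [hg₀, indicator_of_notMem hy, abs_zero, zero_le_one]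
  set η := μ.real B / 2 ^ s with hη
  have hη0 : 0 < η := by positivity
  have hEη : μ.real E ≤ η := by rw [hη, le_div_iff₀' (by positivity)]; exact hEV
  obtain ⟨g, hg, hg1, hgs, hgε⟩ := exists_continuous_approx h hρ hη0 hdm hdi hg₀m hg₀1
  have hgi : Integrable g μ := h.integrable_of_bdd hg.measurable hρ hgs (ae_of_all _ hg1)
  have hg₀i : IntegrableOn g₀ B μ :=
    Measure.integrableOn_of_bounded hBtop hg₀m.aestronglyMeasurable (ae_of_all _ hg₀1)
  have hdg : ∀ f : M → ℝ, Measurable f → (∀ y, |f y| ≤ 1) →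
      IntegrableOn (fun y => d y * f y) B μ := fun f hf hf1 =>
    hdi.mul_bdd (c := 1) hf.aestronglyMeasurable (ae_of_all _ hf1)
  have hbf : ∀ f : M → ℝ, Continuous f → (∀ y ∉ B, f y = 0) → ∀ L, (∀ y, |f y| ≤ L) →
      Integrable (fun y => b y * f y) μ := fun f hf hfs L hfL => by
    refine IntegrableOn.integrable_of_forall_notMem_eq_zero (s := B) ?_ fun y hy => by
      rw [hfs y hy, mul_zero]
    exact (hbi ρ).mul_bdd (c := L) hf.aestronglyMeasurable (ae_of_all _ hfL)
  have hwi : IntegrableOn (fun y => (1 + |d y|) * |g y - g₀ y|) B μ := by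
    refine (((integrableOn_const hBtop (C := (1 : ℝ))).add hdi.abs).mul_bdd (c := 2)
      ((hg.measurable.sub hg₀m).norm.aestronglyMeasurable) (ae_of_all _ fun y => ?_))
    rw [Real.norm_eq_abs, abs_abs]
    have := abs_sub (g y) (g₀ y)
    linarith [hg1 y, hg₀1 y]
  have hgm : ∫ y, |g y| ∂μ ≤ 2 * η := by
    rw [← setIntegral_eq_integral_of_forall_compl_eq_zero (s := B)
      (fun y hy => by rw [hgs y hy, abs_zero])]
    calc ∫ y in B, |g y| ∂μ ≤ ∫ y in B, ((1 + |d y|) * |g y - g₀ y| + |g₀ y|) ∂μ := by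
          refine integral_mono hgi.abs.integrableOn (hwi.add hg₀i.abs) fun y => ?_
          have h1 := abs_add_le (g y - g₀ y) (g₀ y)
          rw [sub_add_cancel] at h1
          have h2 : |g y - g₀ y| ≤ (1 + |d y|) * |g y - g₀ y| :=
            le_mul_of_one_le_left (abs_nonneg _) (by linarith [abs_nonneg (d y)])
          exact h1.trans (add_le_add h2 le_rfl)
      _ = ∫ y in B, (1 + |d y|) * |g y - g₀ y| ∂μ + ∫ y in B, |g₀ y| ∂μ :=
          integral_add hwi hg₀i.abs
      _ ≤ η + μ.real E := by
          gcongr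
          have : ∀ y, |g₀ y| = E.indicator 1 y := fun y => by
            by_cases hy : y ∈ E
            · simp only [hg₀, indicator_of_mem hy, hσ1, Pi.one_apply]
            · simp only [hg₀, indicator_of_notMem hy, abs_zero]
          simp only [this]
          rw [integral_indicator_one hE, measureReal_restrict_apply hE, inter_eq_left.2 hEs]
      _ ≤ 2 * η := by linarith
  have hat := hA s x ρ 1 (2 * η) g hρ (by positivity) hg hgs hg1 hgm (by
    rw [hη, one_mul, mul_left_comm, mul_div_cancel₀ _ (by positivity)]; linarith)
  have hpair := hbT _ _ hat
  have hpe : ∫ y, b y * (g y - (∫ w, g w ∂μ) * bump μ x ρ y) ∂μ = ∫ y in B, d y * g y ∂μ := by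
    rw [setIntegral_eq_integral_of_forall_compl_eq_zero (fun y hy => by rw [hgs y hy, mul_zero])]
    have i1 := hbf g hg hgs 1 hg1
    have i2 := hbf (bump μ x ρ) (continuous_bump x ρ) (fun y hy => bump_eq_zero hρ hy) _
      (abs_bump_le h x hρ)
    calc _ = ∫ y, (b y * g y - (∫ w, g w ∂μ) * (b y * bump μ x ρ y)) ∂μ := by
          congr 1; ext y; ring
      _ = ∫ y, b y * g y ∂μ - (∫ w, g w ∂μ) * c := by
          rw [integral_sub i1 (i2.const_mul _), integral_const_mul]
      _ = ∫ y, (b y * g y - c * g y) ∂μ := by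
          rw [integral_sub i1 (hgi.const_mul c), integral_const_mul, mul_comm c]
      _ = _ := by congr 1; ext y; simp only [hd]; ring
  rw [hpe] at hpair
  have hfinal : ∫ y in E, |d y| ∂μ ≤ C * (s + 1) * (2 * η) + η := by
    calc ∫ y in E, |d y| ∂μ = ∫ y in B, d y * g₀ y ∂μ := by
          have : ∀ y, d y * g₀ y = E.indicator (fun y => |d y|) y := fun y => by
            by_cases hy : y ∈ E
            · simp only [hg₀, indicator_of_mem hy, hσd]
            · simp only [hg₀, indicator_of_notMem hy, mul_zero]
          simp only [this]
          rw [setIntegral_indicator hE, inter_eq_right.2 hEs]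
      _ ≤ ∫ y in B, (d y * g y + (1 + |d y|) * |g y - g₀ y|) ∂μ := by
          refine integral_mono (hdg g₀ hg₀m hg₀1) ((hdg g hg.measurable hg1).add hwi) fun y => ?_
          have h1 : d y * (g₀ y - g y) ≤ |d y| * |g y - g₀ y| := by
            rw [abs_sub_comm (g y), ← abs_mul]; exact le_abs_self _
          have h2 := abs_nonneg (g y - g₀ y)
          show d y * g₀ y ≤ d y * g y + (1 + |d y|) * |g y - g₀ y|
          linarith
      _ = ∫ y in B, d y * g y ∂μ + ∫ y in B, (1 + |d y|) * |g y - g₀ y| ∂μ :=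
          integral_add (hdg g hg.measurable hg1) hwi
      _ ≤ _ := add_le_add ((le_abs_self _).trans hpair) hgε
  calc 2 ^ s * ∫ y in E, |d y| ∂μ ≤ 2 ^ s * (C * (s + 1) * (2 * η) + η) := by gcongr
    _ = (C * (s + 1) * 2 + 1) * μ.real B := by rw [hη]; field_simp
    _ ≤ (2 * C + 1) * (s + 1) * μ.real B := by
        gcongr
        have : (0 : ℝ) ≤ s := Nat.cast_nonneg s
        linarith

end Density

section FinAtomicProperties

variable [BorelSpace M] {μ : Measure M} {D : ℝ}

omit [BorelSpace M] in
lemma BallDoubling.isOpenPosMeasure (h : BallDoubling μ D) : μ.IsOpenPosMeasure :=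
  ⟨fun U hU ⟨x, hx⟩ => by
    obtain ⟨r, hr, hrU⟩ := Metric.isOpen_iff.1 hU x hx
    exact ((h.pos x r hr).trans_le (measure_mono hrU)).ne'⟩

omit [BorelSpace M] in
lemma IsContAtom.exists_bound (h : BallDoubling μ D) {a : M → ℝ} (ha : IsContAtom μ a) :
    ∃ (x : M) (r L : ℝ), 0 < r ∧ (∀ y ∉ ball x r, a y = 0) ∧ (∀ y, |a y| ≤ L) := by
  have := h.isOpenPosMeasure
  obtain ⟨⟨-, x, r, hr, hs, hb, -⟩, hc⟩ := ha
  refine ⟨x, r, ((μ (ball x r)).toReal)⁻¹, hr, hs, fun y => ?_⟩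
  have ho : IsOpen {y | ¬ |a y| ≤ ((μ (ball x r)).toReal)⁻¹} := by
    simpa only [not_le] using isOpen_lt continuous_const hc.abs
  have he := ho.measure_eq_zero_iff μ |>.1 (ae_iff.1 hb)
  by_contra hcon
  exact (he ▸ hcon : y ∈ (∅ : Set M))

omit [BorelSpace M] in
lemma FinAtomic.continuous {S : Set M} {T : ℝ} {f : M → ℝ} (hf : FinAtomic μ S T f) :
    Continuous f := by
  obtain ⟨N, c, b, hb, hf, -⟩ := hf
  rw [funext hf]
  exact continuous_finsetSum _ fun j hj =>
    continuous_const.mul (hb j (Finset.mem_range.1 hj)).1.2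

omit [BorelSpace M] in
lemma FinAtomic.eq_zero {S : Set M} {T : ℝ} {f : M → ℝ} (hf : FinAtomic μ S T f) {y : M}
    (hy : y ∉ S) : f y = 0 := by
  obtain ⟨N, c, b, hb, hf, -⟩ := hf
  rw [hf]
  exact Finset.sum_eq_zero fun j hj => by rw [(hb j (Finset.mem_range.1 hj)).2 y hy, mul_zero]

omit [BorelSpace M] in
lemma FinAtomic.exists_bound (h : BallDoubling μ D) {S : Set M} {T : ℝ} {f : M → ℝ}
    (hf : FinAtomic μ S T f) : ∃ L : ℝ, ∀ y, |f y| ≤ L := by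
  obtain ⟨N, c, b, hb, hf, -⟩ := hf
  have : ∀ j, ∃ L : ℝ, j < N → ∀ y, |b j y| ≤ L := fun j => by
    by_cases hj : j < N
    · obtain ⟨x, r, L, -, -, hL⟩ := IsContAtom.exists_bound h (hb j hj).1
      exact ⟨L, fun _ => hL⟩
    · exact ⟨0, fun hj' => absurd hj' hj⟩
  choose L hL using this
  refine ⟨∑ j ∈ Finset.range N, |c j| * L j, fun y => ?_⟩
  rw [hf]
  refine (Finset.abs_sum_le_sum_abs _ _).trans (Finset.sum_le_sum fun j hj => ?_)
  rw [abs_mul]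
  gcongr
  exact hL j (Finset.mem_range.1 hj) y

omit [BorelSpace M] in
lemma FinAtomic.integral_eq_zero (h : BallDoubling μ D) {S : Set M} {T : ℝ} {f : M → ℝ}
    (hf : FinAtomic μ S T f) : ∫ y, f y ∂μ = 0 := by
  obtain ⟨N, c, b, hb, hf, -⟩ := hf
  simp only [hf]
  rw [integral_finsetSum]
  · refine Finset.sum_eq_zero fun j hj => ?_
    obtain ⟨⟨-, x, r, -, -, -, h0⟩, -⟩ := (hb j (Finset.mem_range.1 hj)).1
    rw [integral_const_mul, h0, mul_zero]
  · intro j hj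
    obtain ⟨⟨hm, x, r, hr, hs, hL, -⟩, -⟩ := (hb j (Finset.mem_range.1 hj)).1
    exact (h.integrable_of_bdd hm hr hs hL).const_mul _

omit [BorelSpace M] in
lemma FinAtomic.exists_ball (x₀ : M) {S : Set M} {T : ℝ} {f : M → ℝ}
    (hf : FinAtomic μ S T f) : ∃ ρ : ℝ, 0 < ρ ∧ FinAtomic μ (ball x₀ ρ) T f := by
  obtain ⟨N, c, b, hb, hf, hT⟩ := hf
  have : ∀ j, ∃ R : ℝ, 0 ≤ R ∧ (j < N → ∀ y ∉ ball x₀ R, b j y = 0) := fun j => by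
    by_cases hj : j < N
    · obtain ⟨⟨-, x, r, hr, hs, -, -⟩, -⟩ := (hb j hj).1
      exact ⟨r + dist x x₀, by positivity, fun _ y hy =>
        hs y fun hy' => hy (ball_subset_ball' le_rfl hy')⟩
    · exact ⟨0, le_rfl, fun hj' => absurd hj' hj⟩
  choose R hR0 hR using this
  refine ⟨1 + ∑ j ∈ Finset.range N, R j, ?_, N, c, b, fun j hj => ⟨(hb j hj).1, fun y hy =>
    hR j hj y fun hy' => hy (ball_subset_ball ?_ hy')⟩, hf, hT⟩
  · have := Finset.sum_nonneg fun j (_ : j ∈ Finset.range N) => hR0 j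
    linarith
  · have := Finset.single_le_sum (fun j _ => hR0 j) (Finset.mem_range.2 hj)
    linarith

end FinAtomicProperties

section Pairing

variable [BorelSpace M] {μ : Measure M} {D : ℝ}

omit [BorelSpace M] in
/-- If `b` is close in mean to a constant on the ball of an atom `a`, then the pairing of `a` with
a truncation of `b` is controlled. -/
lemma abs_integral_clamp_mul_le (h : BallDoubling μ D) {b a : M → ℝ} {x : M} {r n c c₀ C : ℝ}
    (hr : 0 < r) (hn : 0 ≤ n) (hb : Measurable b) (hbi : IntegrableOn b (ball x r) μ)
    (ha : Measurable a) (has : ∀ y ∉ ball x r, a y = 0)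
    (hab : ∀ᵐ y ∂μ, |a y| ≤ ((μ (ball x r)).toReal)⁻¹) (ha0 : ∫ y, a y ∂μ = 0)
    (hC : ∫ y in ball x r, |b y - c| ∂μ ≤ C * μ.real (ball x r)) :
    |∫ y, clamp n (b y - c₀) * a y ∂μ| ≤ C := by
  have hV := h.real_pos x hr
  have hai := h.integrable_of_bdd ha hr has hab
  have hbm : Measurable fun y => clamp n (b y - c₀) :=
    (continuous_clamp n).measurable.comp (hb.sub measurable_const)
  have hi : Integrable (fun y => clamp n (b y - c₀) * a y) μ :=
    hai.bdd_mul (c := n) hbm.aestronglyMeasurable (ae_of_all _ fun y => abs_clamp_le hn _)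
  have hbci : IntegrableOn (fun y => |b y - c|) (ball x r) μ :=
    (hbi.sub (integrableOn_const (h.lt_top x r hr).ne)).abs
  have e : ∫ y, clamp n (b y - c₀) * a y ∂μ =
      ∫ y in ball x r, (clamp n (b y - c₀) - clamp n (c - c₀)) * a y ∂μ := by
    rw [setIntegral_eq_integral_of_forall_compl_eq_zero
      (fun y hy => by rw [has y hy, mul_zero])]
    simp only [sub_mul]
    rw [integral_sub hi (hai.const_mul _), integral_const_mul, ha0, mul_zero, sub_zero]
  rw [e]
  refine abs_integral_le_integral_abs.trans ?_
  calc _ ≤ ∫ y in ball x r, |b y - c| * (μ.real (ball x r))⁻¹ ∂μ := by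
        refine integral_mono_of_nonneg (ae_of_all _ fun y => abs_nonneg _)
          (hbci.mul_const _) ?_
        filter_upwards [ae_restrict_of_ae hab] with y hy
        rw [abs_mul]
        have h1 := abs_clamp_sub_clamp_le n (b y - c₀) (c - c₀)
        rw [sub_sub_sub_cancel_right] at h1
        exact mul_le_mul h1 hy (abs_nonneg _) (abs_nonneg _)
    _ = (∫ y in ball x r, |b y - c| ∂μ) * (μ.real (ball x r))⁻¹ := integral_mul_const _ _
    _ ≤ C * μ.real (ball x r) * (μ.real (ball x r))⁻¹ := by gcongr
    _ = C := by field_simp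

/-- The pairing of `f` with a test function of unit dual norm is controlled by any atomic
decomposition of `f`. -/
lemma exists_abs_integral_mul_le [LocallyCompactSpace M] (h : BallDoubling μ D) :
    ∃ C : ℝ, 0 < C ∧ ∀ (x₀ : M) (ρ L Λ : ℝ) (f : M → ℝ), 0 < ρ → 0 < Λ → Continuous f →
      (∀ y ∉ ball x₀ ρ, f y = 0) → (∀ y, |f y| ≤ L) → ∫ y, f y ∂μ = 0 →
      ∀ (lam : ℕ → ℝ) (a : ℕ → M → ℝ), (∀ k, IsOneInfAtom μ (a k)) →
        (∀ n, ∑ k ∈ Finset.range n, |lam k| ≤ Λ) →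
        Tendsto (fun n => ∫ x, |f x - ∑ k ∈ Finset.range n, lam k * a k x| ∂μ) atTop (nhds 0) →
        ∃ R : ℝ, 0 < R ∧ ∀ b : M → ℝ, Measurable b → (∀ x r, IntegrableOn b (ball x r) μ) →
          (∀ t g, FinAtomic μ (ball x₀ R) t g → |∫ y, b y * g y ∂μ| ≤ t) →
          |∫ y, b y * f y ∂μ| ≤ C * Λ := by
  obtain ⟨C, hC, Rf, hE⟩ := exists_setIntegral_abs_sub_le h
  refine ⟨C + 1, by positivity,
    fun x₀ ρ L Λ f hρ hΛ hf hfs hfL hf0 lam a ha hlam hlim => ?_⟩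
  choose ham x r hr has hab ha0 using ha
  have hV := h.real_pos x₀ hρ
  have hL : 0 ≤ L := (abs_nonneg _).trans (hfL x₀)
  have hai : ∀ k, Integrable (a k) μ := fun k =>
    h.integrable_of_bdd (ham k) (hr k) (has k) (hab k)
  have hfi : Integrable f μ := h.integrable_of_bdd hf.measurable hρ hfs (ae_of_all _ hfL)
  obtain ⟨s, hs⟩ : ∃ s : ℕ, L * (C * (s + 1) * μ.real (ball x₀ ρ)) ≤ 2 ^ s * (Λ / 4) := by
    have h1 := (tendsto_add_atTop_iff_nat 1).2
      (tendsto_pow_const_div_const_pow_of_one_lt 1 (one_lt_two (α := ℝ)))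
    set q := 2 * (L * (C * μ.real (ball x₀ ρ)) + 1) with hq
    have hq0 : 0 < q := by positivity
    obtain ⟨s, hs⟩ := (h1.eventually (gt_mem_nhds (by positivity : 0 < Λ / 4 / q))).exists
    refine ⟨s, ?_⟩
    rw [pow_one, div_lt_div_iff₀ (by positivity) hq0, pow_succ] at hs
    push_cast at hs
    have : (0 : ℝ) ≤ s := Nat.cast_nonneg s
    have h2 : 2 * (L * (C * (s + 1) * μ.real (ball x₀ ρ))) ≤ (s + 1) * q := by
      rw [hq]; nlinarith
    linarith
  set n : ℝ := C * 2 ^ s with hn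
  have hn0 : 0 < n := by positivity
  obtain ⟨N, hN⟩ := (hlim.eventually (gt_mem_nhds (by positivity : 0 < Λ / 4 / n))).exists
  set R : ℝ := 1 + |Rf s * ρ| + |Rf 0 * ρ| + ∑ k ∈ Finset.range N, |Rf 0 * r k + dist (x k) x₀|
    with hR
  have hsum0 : 0 ≤ ∑ k ∈ Finset.range N, |Rf 0 * r k + dist (x k) x₀| :=
    Finset.sum_nonneg fun _ _ => abs_nonneg _
  have hR1 : ball x₀ (Rf s * ρ) ⊆ ball x₀ R := ball_subset_ball (by
    have := le_abs_self (Rf s * ρ); have := abs_nonneg (Rf 0 * ρ); linarith)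
  have hR2 : ball x₀ (Rf 0 * ρ) ⊆ ball x₀ R := ball_subset_ball (by
    have := le_abs_self (Rf 0 * ρ); have := abs_nonneg (Rf s * ρ); linarith)
  have hR3 : ∀ k ∈ Finset.range N, ball (x k) (Rf 0 * r k) ⊆ ball x₀ R := fun k hk =>
    ball_subset_ball' (by
      have h1 := Finset.single_le_sum
        (f := fun k => |Rf 0 * r k + dist (x k) x₀|) (fun _ _ => abs_nonneg _) hk
      have h2 := le_abs_self (Rf 0 * r k + dist (x k) x₀)
      have := abs_nonneg (Rf 0 * ρ); have := abs_nonneg (Rf s * ρ)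
      linarith)
  refine ⟨R, by positivity, fun b hb hbi hbT => ?_⟩
  set B := ball x₀ ρ with hB
  set c₀ := ∫ w, b w * bump μ x₀ ρ w ∂μ with hc₀
  set d : M → ℝ := fun y => b y - c₀ with hd
  have hdm : Measurable d := hb.sub measurable_const
  have hdi : IntegrableOn d B μ := (hbi _ _).sub (integrableOn_const (h.lt_top x₀ ρ hρ).ne)
  have hB0 : ∫ y in B, |d y| ∂μ ≤ C * μ.real B := by
    have := hE 0 x₀ ρ b B hρ hb (hbi x₀) (fun t g hg => hbT t g (hg.mono hR2 le_rfl))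
      measurableSet_ball subset_rfl (by rw [pow_zero, one_mul])
    simpa using this
  set A : Set M := B ∩ {y | n < |d y|} with hA
  have hAm : MeasurableSet A :=
    measurableSet_ball.inter (measurableSet_lt measurable_const hdm.abs)
  have hAB : A ⊆ B := inter_subset_left
  have hAtop : μ A ≠ ⊤ := ((measure_mono hAB).trans_lt (h.lt_top x₀ ρ hρ)).ne
  have hAμ : 2 ^ s * μ.real A ≤ μ.real B := by
    have h1 : n * μ.real A ≤ C * μ.real B := by
      calc n * μ.real A = ∫ y in A, n ∂μ := by simp [mul_comm]
        _ ≤ ∫ y in A, |d y| ∂μ :=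
          setIntegral_mono_on (integrableOn_const hAtop) (hdi.mono_set hAB).abs hAm
            fun y hy => le_of_lt hy.2
        _ ≤ ∫ y in B, |d y| ∂μ :=
          setIntegral_mono_set hdi.abs (ae_of_all _ fun _ => abs_nonneg _) hAB.eventuallyLE
        _ ≤ _ := hB0
    rw [hn, mul_assoc] at h1
    exact le_of_mul_le_mul_left h1 hC
  have hA2 : L * ∫ y in A, |d y| ∂μ ≤ Λ / 4 := by
    have h1 := hE s x₀ ρ b A hρ hb (hbi x₀) (fun t g hg => hbT t g (hg.mono hR1 le_rfl))
      hAm hAB hAμ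
    have h2 : 2 ^ s * (L * ∫ y in A, |d y| ∂μ) ≤ 2 ^ s * (Λ / 4) := by
      calc _ = L * (2 ^ s * ∫ y in A, |d y| ∂μ) := by ring
        _ ≤ L * (C * (s + 1) * μ.real B) := by gcongr
        _ ≤ _ := hs
    exact le_of_mul_le_mul_left h2 (by positivity)
  set β : M → ℝ := fun y => clamp n (d y) with hβ
  have hβm : Measurable β := (continuous_clamp n).measurable.comp hdm
  have hβn : ∀ y, |β y| ≤ n := fun y => abs_clamp_le hn0.le _
  have hβi : ∀ g : M → ℝ, Integrable g μ → Integrable (fun y => β y * g y) μ := fun g hg =>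
    hg.bdd_mul (c := n) hβm.aestronglyMeasurable (ae_of_all _ hβn)
  have hbfi : Integrable (fun y => b y * f y) μ := by
    refine IntegrableOn.integrable_of_forall_notMem_eq_zero (s := B) ?_ fun y hy => by
      rw [hfs y hy, mul_zero]
    exact (hbi _ _).mul_bdd (c := L) hf.aestronglyMeasurable (ae_of_all _ hfL)
  have hdfi : Integrable (fun y => d y * f y) μ := by
    have := hbfi.sub (hfi.const_mul c₀)
    refine this.congr (ae_of_all _ fun y => ?_)
    simp only [hd, Pi.sub_apply]; ring
  have e1 : ∫ y, b y * f y ∂μ = ∫ y, (d y - β y) * f y ∂μ + ∫ y, β y * f y ∂μ := by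
    have hdβ : Integrable (fun y => (d y - β y) * f y) μ :=
      (hdfi.sub (hβi f hfi)).congr (ae_of_all _ fun y => by simp only [Pi.sub_apply]; ring)
    rw [← integral_add hdβ (hβi f hfi)]
    have : ∀ y, (d y - β y) * f y + β y * f y = b y * f y - c₀ * f y := fun y => by
      simp only [hd]; ring
    simp only [this]
    rw [integral_sub hbfi (hfi.const_mul _), integral_const_mul, hf0, mul_zero, sub_zero]
  have e2 : |∫ y, (d y - β y) * f y ∂μ| ≤ Λ / 4 := by
    refine le_trans ?_ hA2
    refine abs_integral_le_integral_abs.trans ?_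
    rw [← integral_const_mul, ← setIntegral_eq_integral_of_forall_compl_eq_zero (s := A)]
    · refine integral_mono_of_nonneg (ae_of_all _ fun y => abs_nonneg _)
        ((hdi.mono_set hAB).abs.const_mul L) (ae_of_all _ fun y => ?_)
      show |(d y - β y) * f y| ≤ L * |d y|
      rw [abs_mul, mul_comm]
      have h1 := abs_clamp_add_abs_sub_clamp hn0.le (d y)
      have h2 := abs_nonneg (clamp n (d y))
      refine mul_le_mul (hfL y) ?_ (abs_nonneg _) hL
      simp only [hβ]; linarith
    · intro y hy
      by_cases hyB : y ∈ B
      · have : |d y| ≤ n := not_lt.1 fun hcon => hy ⟨hyB, hcon⟩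
        simp only [hβ, clamp_eq_self this, sub_self, zero_mul, abs_zero]
      · rw [hfs y hyB, mul_zero, abs_zero]
  have hSi : Integrable (fun y => ∑ k ∈ Finset.range N, lam k * a k y) μ :=
    integrable_finsetSum _ fun k _ => (hai k).const_mul _
  have e3 : |∫ y, β y * (f y - ∑ k ∈ Finset.range N, lam k * a k y) ∂μ| ≤ Λ / 4 := by
    refine abs_integral_le_integral_abs.trans ?_
    calc _ ≤ ∫ y, n * |f y - ∑ k ∈ Finset.range N, lam k * a k y| ∂μ := by
          refine integral_mono_of_nonneg (ae_of_all _ fun y => abs_nonneg _)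
            ((hfi.sub hSi).abs.const_mul n) (ae_of_all _ fun y => ?_)
          show |β y * _| ≤ _
          rw [abs_mul]
          exact mul_le_mul_of_nonneg_right (hβn y) (abs_nonneg _)
      _ = n * ∫ y, |f y - ∑ k ∈ Finset.range N, lam k * a k y| ∂μ := integral_const_mul _ _
      _ ≤ n * (Λ / 4 / n) := by gcongr
      _ = Λ / 4 := by field_simp
  have e4 : |∫ y, β y * ∑ k ∈ Finset.range N, lam k * a k y ∂μ| ≤ C * Λ := by
    have : ∀ y, β y * ∑ k ∈ Finset.range N, lam k * a k y =
        ∑ k ∈ Finset.range N, lam k * (β y * a k y) := fun y => by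
      rw [Finset.mul_sum]; exact Finset.sum_congr rfl fun k _ => by ring
    simp only [this]
    rw [integral_finsetSum _ fun k _ => (hβi _ (hai k)).const_mul _]
    refine (Finset.abs_sum_le_sum_abs _ _).trans ?_
    calc _ ≤ ∑ k ∈ Finset.range N, |lam k| * C := by
          refine Finset.sum_le_sum fun k hk => ?_
          rw [integral_const_mul, abs_mul]
          gcongr
          refine abs_integral_clamp_mul_le h (c := ∫ w, b w * bump μ (x k) (r k) w ∂μ)
            (hr k) hn0.le hb (hbi _ _) (ham k) (has k) (hab k) (ha0 k) ?_
          have := hE 0 (x k) (r k) b (ball (x k) (r k)) (hr k) hb (hbi _)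
            (fun t g hg => hbT t g (hg.mono (hR3 k hk) le_rfl))
            measurableSet_ball subset_rfl (by rw [pow_zero, one_mul])
          simpa using this
      _ = C * ∑ k ∈ Finset.range N, |lam k| := by rw [← Finset.sum_mul, mul_comm]
      _ ≤ C * Λ := by gcongr; exact hlam N
  have e5 : ∫ y, β y * f y ∂μ = ∫ y, β y * (f y - ∑ k ∈ Finset.range N, lam k * a k y) ∂μ +
      ∫ y, β y * ∑ k ∈ Finset.range N, lam k * a k y ∂μ := by
    have h1 : Integrable (fun y => β y * (f y - ∑ k ∈ Finset.range N, lam k * a k y)) μ :=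
      hβi _ (hfi.sub hSi)
    rw [← integral_add h1 (hβi _ hSi)]
    congr 1; ext y; ring
  rw [e1, e5]
  have t1 := abs_add_le (∫ y, (d y - β y) * f y ∂μ)
    (∫ y, β y * (f y - ∑ k ∈ Finset.range N, lam k * a k y) ∂μ +
      ∫ y, β y * ∑ k ∈ Finset.range N, lam k * a k y ∂μ)
  have t2 := abs_add_le (∫ y, β y * (f y - ∑ k ∈ Finset.range N, lam k * a k y) ∂μ)
      (∫ y, β y * ∑ k ∈ Finset.range N, lam k * a k y ∂μ)
  linarith

end Pairing

section Duality

variable [BorelSpace M] {μ : Measure M} {D : ℝ}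

omit [BorelSpace M] in
lemma BallDoubling.memLp_two (h : BallDoubling μ D) {g : M → ℝ} (hg : Measurable g) {x : M}
    {r K : ℝ} (hr : 0 < r) (hs : ∀ y ∉ ball x r, g y = 0) (hK : ∀ y, |g y| ≤ K) :
    MemLp g 2 μ := by
  refine (memLp_two_iff_integrable_sq hg.aestronglyMeasurable).2
    (h.integrable_of_bdd (K := K ^ 2) (hg.pow_const 2) hr
      (fun y hy => by rw [hs y hy, zero_pow two_ne_zero]) (ae_of_all _ fun y => ?_))
  rw [abs_pow]
  exact pow_le_pow_left₀ (abs_nonneg _) (hK y) 2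

omit [MetricSpace M] [BorelSpace M] in
lemma inner_toLp_right (F : Lp ℝ 2 μ) {g : M → ℝ} (hg : MemLp g 2 μ) :
    inner ℝ F (hg.toLp g) = ∫ y, F y * g y ∂μ := by
  rw [L2.inner_def]
  refine integral_congr_ae ?_
  filter_upwards [hg.coeFn_toLp] with y hy
  rw [hy, real_inner_comm]
  simp

omit [MetricSpace M] [BorelSpace M] in
lemma norm_toLp_sub_sq {f g : M → ℝ} (hf : MemLp f 2 μ) (hg : MemLp g 2 μ) :
    ‖hf.toLp f - hg.toLp g‖ ^ 2 = ∫ y, (f y - g y) ^ 2 ∂μ := by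
  rw [← real_inner_self_eq_norm_sq, ← MemLp.toLp_sub, inner_toLp_right]
  refine integral_congr_ae ?_
  filter_upwards [(hf.sub hg).coeFn_toLp] with y hy
  rw [hy, Pi.sub_apply, sq]

/-- If every test function in the polar of the finite atomic ball pairs with `f` to at most `T`,
then `f` is approximated in `L²` by finite atomic functions of size at most `T`. -/
lemma exists_finAtomic_integral_sub_sq_le (h : BallDoubling μ D) {x₀ : M} {ρ R L T δ : ℝ}
    {f : M → ℝ} (hρ : 0 < ρ) (hR : 0 < R) (hT : 0 < T) (hδ : 0 < δ) (hf : Continuous f)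
    (hfs : ∀ y ∉ ball x₀ ρ, f y = 0) (hfL : ∀ y, |f y| ≤ L)
    (hdual : ∀ b : M → ℝ, Measurable b → (∀ x r, IntegrableOn b (ball x r) μ) →
      (∀ t g, FinAtomic μ (ball x₀ R) t g → |∫ y, b y * g y ∂μ| ≤ t) → |∫ y, b y * f y ∂μ| ≤ T) :
    ∃ g, FinAtomic μ (ball x₀ R) T g ∧ ∫ y, (f y - g y) ^ 2 ∂μ ≤ δ := by
  have hmem : ∀ {t g}, FinAtomic μ (ball x₀ R) t g → MemLp g 2 μ := fun {t g} hg => by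
    obtain ⟨K, hK⟩ := hg.exists_bound h
    exact h.memLp_two hg.continuous.measurable hR (fun y hy => hg.eq_zero hy) hK
  have hf2 : MemLp f 2 μ := h.memLp_two hf.measurable hρ hfs hfL
  set S : Set (Lp ℝ 2 μ) :=
    {G | ∃ (g : M → ℝ) (hg : FinAtomic μ (ball x₀ R) T g), G = (hmem hg).toLp g} with hS
  have hconv : Convex ℝ S := by
    rintro _ ⟨g₁, hg₁, rfl⟩ _ ⟨g₂, hg₂, rfl⟩ s t hs ht hst
    have hg : FinAtomic μ (ball x₀ R) T (fun y => s * g₁ y + t * g₂ y) :=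
      ((hg₁.smul s).add (hg₂.smul t)).mono subset_rfl (by
        rw [abs_of_nonneg hs, abs_of_nonneg ht, ← add_mul, hst, one_mul])
    refine ⟨_, hg, ?_⟩
    rw [← MemLp.toLp_const_smul, ← MemLp.toLp_const_smul, ← MemLp.toLp_add]
    rfl
  by_cases hcl : hf2.toLp f ∈ closure S
  · obtain ⟨_, ⟨g, hg, rfl⟩, hd⟩ := Metric.mem_closure_iff.1 hcl (√δ) (Real.sqrt_pos.2 hδ)
    refine ⟨g, hg, ?_⟩
    rw [← norm_toLp_sub_sq hf2 (hmem hg), ← dist_eq_norm, ← Real.sq_sqrt hδ.le]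
    exact pow_le_pow_left₀ dist_nonneg hd.le 2
  exfalso
  obtain ⟨φ, u, hφS, hφf⟩ := geometric_hahn_banach_closed_point hconv.closure isClosed_closure hcl
  set F : Lp ℝ 2 μ := (InnerProductSpace.toDual ℝ (Lp ℝ 2 μ)).symm φ with hF
  have hφ : ∀ {g : M → ℝ} (hg : MemLp g 2 μ), φ (hg.toLp g) = ∫ y, F y * g y ∂μ := fun hg => by
    rw [← inner_toLp_right, hF, InnerProductSpace.toDual_symm_apply]
  have hlt : ∀ g, FinAtomic μ (ball x₀ R) T g → ∫ y, F y * g y ∂μ < u := fun g hg => by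
    rw [← hφ (hmem hg)]
    exact hφS _ (subset_closure ⟨g, hg, rfl⟩)
  have hu : 0 < u := by
    simpa using hlt _ (FinAtomic.zero hT.le)
  have hpos : ∀ t g, 0 < t → FinAtomic μ (ball x₀ R) t g → |∫ y, T / u * F y * g y ∂μ| ≤ t := by
    intro t g ht hg
    have key : ∀ σ : ℝ, |σ| = 1 → σ * ∫ y, F y * g y ∂μ ≤ t / T * u := fun σ hσ => by
      have h1 := hlt _ ((hg.smul (σ * (T / t))).mono subset_rfl (by
        rw [abs_mul, hσ, one_mul, abs_of_pos (by positivity)]; field_simp; rfl))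
      have h2 : ∀ y, F y * (σ * (T / t) * g y) = T / t * (σ * (F y * g y)) := fun y => by ring
      simp only [h2, integral_const_mul] at h1
      rw [div_mul_eq_mul_div, div_lt_iff₀ ht] at h1
      rw [div_mul_eq_mul_div, le_div_iff₀ hT]
      linarith
    simp only [mul_assoc]
    rw [integral_const_mul, abs_mul, abs_of_pos (by positivity), div_mul_eq_mul_div, div_le_iff₀ hu,
      mul_comm T, ← le_div_iff₀ hT, ← div_mul_eq_mul_div]
    refine abs_le'.2 ⟨by simpa using key 1 (by simp), by simpa using key (-1) (by simp)⟩
  have hb := hdual (fun y => T / u * F y)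
    ((Lp.stronglyMeasurable F).measurable.const_mul _) (fun x r => ?_) (fun t g hg => ?_)
  · simp only [mul_assoc] at hb
    rw [integral_const_mul, ← hφ hf2, abs_mul, abs_of_pos (by positivity), div_mul_eq_mul_div,
      div_le_iff₀ hu] at hb
    have := le_of_mul_le_mul_left hb hT
    exact absurd (hφf.trans_le ((le_abs_self _).trans this)) (lt_irrefl _)
  · have hfin : IsFiniteMeasure (μ.restrict (ball x r)) := by
      refine ⟨?_⟩
      rw [Measure.restrict_apply_univ]
      exact (measure_mono (ball_subset_ball (le_max_left r 1))).trans_lt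
        (h.lt_top x (max r 1) (by positivity))
    exact (((Lp.memLp F).restrict _).integrable one_le_two).const_mul _
  · refine le_of_forall_pos_le_add fun ε hε => hpos (t + ε) g ?_ (hg.mono subset_rfl ?_)
    · have := hg.nonneg
      linarith
    · linarith

/-- A countable atomic decomposition of a finite combination of continuous atoms can be replaced by
a finite continuous one of comparable size. -/
lemma exists_finAtomic_of_tendsto [LocallyCompactSpace M] (h : BallDoubling μ D) (x₀ : M) :
    ∃ C : ℝ, 0 < C ∧ ∀ (T : ℝ) (f : M → ℝ), FinAtomic μ univ T f →
      ∀ (lam : ℕ → ℝ) (a : ℕ → M → ℝ), (∀ k, IsOneInfAtom μ (a k)) →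
        Summable (fun k => |lam k|) →
        Tendsto (fun n => ∫ x, |f x - ∑ k ∈ Finset.range n, lam k * a k x| ∂μ) atTop (nhds 0) →
        FinAtomic μ univ (C * ∑' k, |lam k|) f := by
  obtain ⟨C, hC, hP⟩ := exists_abs_integral_mul_le h
  refine ⟨C + 1, by positivity, fun T f hfT lam a ha hlam hlim => ?_⟩
  obtain ⟨ρ, hρ, hfρ⟩ := hfT.exists_ball x₀
  obtain ⟨L, hL⟩ := hfT.exists_bound h
  have hfc := hfT.continuous
  have hf0 := hfT.integral_eq_zero h
  have hfs : ∀ y ∉ ball x₀ ρ, f y = 0 := fun y hy => hfρ.eq_zero hy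
  have hfi : Integrable f μ := h.integrable_of_bdd hfc.measurable hρ hfs (ae_of_all _ hL)
  set Λ := ∑' k, |lam k| with hΛdef
  have hΛ0 : 0 ≤ Λ := tsum_nonneg fun k => abs_nonneg (lam k)
  rcases hΛ0.eq_or_lt with hΛ | hΛ
  · have hz : ∀ k, lam k = 0 := fun k => by
      have := hlam.le_tsum k fun j _ => abs_nonneg _
      rw [← hΛdef, ← hΛ] at this
      exact abs_nonpos_iff.1 this
    simp only [hz, zero_mul, Finset.sum_const_zero, sub_zero] at hlim
    have h1 := tendsto_nhds_unique hlim tendsto_const_nhds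
    have h2 := (integral_eq_zero_iff_of_nonneg (fun y => abs_nonneg (f y)) hfi.abs).1 h1.symm
    have := h.isOpenPosMeasure
    have h3 := (Continuous.ae_eq_iff_eq (g := fun _ => 0) μ hfc.abs continuous_const).1 h2
    rw [← hΛ, mul_zero]
    exact (FinAtomic.zero le_rfl).congr fun y => abs_eq_zero.1 (congrFun h3 y)
  · obtain ⟨R, hR, hRb⟩ := hP x₀ ρ L Λ f hρ hΛ hfc hfs hL hf0 lam a ha
      (fun n => hlam.sum_le_tsum _ fun k _ => abs_nonneg _) hlim
    obtain ⟨δ, hδ, he⟩ :=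
      exists_finAtomic_of_integral_sq_le h x₀ (lt_max_of_lt_left hR : 0 < max R ρ) hΛ
    obtain ⟨g, hg, hgδ⟩ := exists_finAtomic_integral_sub_sq_le h hρ hR (mul_pos hC hΛ) hδ hfc hfs hL
      hRb
    obtain ⟨K, hK⟩ := hg.exists_bound h
    have hgi : Integrable g μ := h.integrable_of_bdd hg.continuous.measurable hR
      (fun y hy => hg.eq_zero hy) (ae_of_all _ hK)
    have h1 := he (L + K) (fun y => f y - g y) (hfc.sub hg.continuous)
      (fun y hy => by
        rw [hfs y fun hy' => hy (ball_subset_ball (le_max_right _ _) hy'),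
          hg.eq_zero fun hy' => hy (ball_subset_ball (le_max_left _ _) hy'), sub_zero])
      (fun y => (abs_sub _ _).trans (add_le_add (hL y) (hK y)))
      (by rw [integral_sub hfi hgi, hf0, hg.integral_eq_zero h, sub_zero]) hgδ
    refine (((hg.mono (subset_univ _) le_rfl).add h1).mono subset_rfl
      (by rw [add_mul, one_mul])).congr fun y => ?_
    ring

end Duality

end FiniteAtomic

/-- Equivalence of the `H¹` and `F^C` norms on finite linear combinations
of continuous `(1,∞)`-atoms: there is a constant `C` such that any countable atomic
decomposition `f = Σ λ_k a_k` (in `L¹(μ)`) of such an `f` can be replaced by a finite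
decomposition into continuous atoms with `Σ |c_j| ≤ C · Σ |λ_k|`. -/
theorem stmt12 {M : Type*} [MetricSpace M] [MeasurableSpace M] [BorelSpace M]
    [LocallyCompactSpace M]
    (μ : Measure M)
    (hμ : ∀ (x : M) (r : ℝ), 0 < r → 0 < μ (ball x r) ∧ μ (ball x r) < ⊤)
    (hinf : μ Set.univ = ⊤)
    (D : ℝ) (hD : 1 ≤ D)
    (hdoub : ∀ (x : M) (r : ℝ), 0 < r →
      μ (ball x (2 * r)) ≤ ENNReal.ofReal D * μ (ball x r)) :
    ∃ C : ℝ, 0 < C ∧ ∀ f : M → ℝ,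
      (∃ (N : ℕ) (c : ℕ → ℝ) (b : ℕ → M → ℝ),
        (∀ j, j < N → IsContAtom μ (b j)) ∧
        ∀ x, f x = ∑ j ∈ Finset.range N, c j * b j x) →
      ∀ (lam : ℕ → ℝ) (a : ℕ → M → ℝ),
        (∀ k, IsOneInfAtom μ (a k)) →
        Summable (fun k => |lam k|) →
        Tendsto (fun n => ∫ x, |f x - ∑ k ∈ Finset.range n, lam k * a k x| ∂μ)
          atTop (nhds 0) →
        ∃ (N : ℕ) (c : ℕ → ℝ) (b : ℕ → M → ℝ),
          (∀ j, j < N → IsContAtom μ (b j)) ∧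
          (∀ x, f x = ∑ j ∈ Finset.range N, c j * b j x) ∧
          ∑ j ∈ Finset.range N, |c j| ≤ C * ∑' k, |lam k| := by
  obtain hM | ⟨⟨x₀⟩⟩ := isEmpty_or_nonempty M
  · simp [Set.eq_empty_of_isEmpty] at hinf
  have h : FiniteAtomic.BallDoubling μ D :=
    ⟨hD, fun x r hr => (hμ x r hr).1, fun x r hr => (hμ x r hr).2, hdoub⟩
  obtain ⟨C, hC, hF⟩ := FiniteAtomic.exists_finAtomic_of_tendsto h x₀
  refine ⟨C, hC, fun f ⟨N, c, b, hb, hf⟩ lam a ha hlam hlim => ?_⟩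
  obtain ⟨N', c', b', hb', hf', hc'⟩ := hF _ f
    ⟨N, c, b, fun j hj => ⟨hb j hj, fun y hy => absurd (Set.mem_univ y) hy⟩, hf, le_rfl⟩
    lam a ha hlam hlim
  exact ⟨N', c', b', fun j hj => (hb' j hj).1, hf', hc'⟩
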